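/- arXiv:1609.01133 — 10 statements merged into one kernel-verified Lean document; each statement's English description precedes it below -/
import Mathlib

section
/- The only 2-permutation numerical semigroups are ⟨{1,2}⟩ = ℕ, ⟨{2,3}⟩ = {0} ∪ {x ∈ ℕ : x ≥ 2}, and ⟨{3,4}⟩ = {0,3,4} ∪ {x ∈ ℕ : x ≥ 6}. That is, a numerical semigroup G is a 2-permutation numerical semigroup if and only if G is one of these three semigroups. -/
/-- The increasing enumeration of the positive elements of a submonoid `G` of `ℕ`
(0-indexed: `posSeq G 0` is the smallest positive element `g₁` of `G`). -/
noncomputable def posSeq (G : AddSubmonoid ℕ) : ℕ → ℕ :=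
  Nat.nth (fun x => x ∈ G ∧ 0 < x)

/-- `G` is an `n`-permutation numerical semigroup: `G` is a cofinite submonoid of `ℕ`,
it is generated by its `n` smallest positive elements `g₁ < ⋯ < gₙ`, and for every
`k ≥ 0` the tuple `(g_{kn+1} mod n, …, g_{kn+n} mod n)` contains exactly one
representative of each residue class of `ℤ/nℤ`. -/
def IsPermutationSemigroup (n : ℕ) (G : AddSubmonoid ℕ) : Prop :=
  ((G : Set ℕ)ᶜ).Finite ∧
  G = AddSubmonoid.closure (posSeq G '' Set.Iio n) ∧
  ∀ k : ℕ, Function.Bijective (fun j : Fin n => ((posSeq G (k * n + j.val) : ℕ) : ZMod n))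

lemma step_aux {p : ℕ → Prop} (hp : (Set.ofPred p).Infinite) {n x y : ℕ} (hx : Nat.nth p n = x)
    (hxy : x < y) (hy : p y) (hno : ∀ z, x < z → z < y → ¬ p z) : Nat.nth p (n + 1) = y := by
  have h1 : Nat.nth p n < Nat.nth p (n + 1) := Nat.nth_strictMono hp (Nat.lt_succ_self n)
  have h2 : p (Nat.nth p (n + 1)) := Nat.nth_mem_of_infinite hp _
  obtain ⟨m, hm⟩ : y ∈ Set.range (Nat.nth p) := by
    rw [Nat.range_nth_of_infinite hp]; exact hy
  have h3 : n < m := by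
    rw [← (Nat.nth_strictMono hp).lt_iff_lt]; omega
  have h4 : Nat.nth p (n + 1) ≤ Nat.nth p m := (Nat.nth_strictMono hp).monotone h3
  by_contra hne
  exact hno _ (by omega) (by omega) h2

lemma zero_aux {p : ℕ → Prop} (hp : (Set.ofPred p).Infinite) {y : ℕ}
    (hy : p y) (hno : ∀ z, z < y → ¬ p z) : Nat.nth p 0 = y := by
  have h2 : p (Nat.nth p 0) := Nat.nth_mem_of_infinite hp _
  obtain ⟨m, hm⟩ : y ∈ Set.range (Nat.nth p) := by
    rw [Nat.range_nth_of_infinite hp]; exact hy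
  have h4 : Nat.nth p 0 ≤ Nat.nth p m := (Nat.nth_strictMono hp).monotone (Nat.zero_le m)
  by_contra hne
  exact hno _ (by omega) h2

lemma bij_aux (f : Fin 2 → ZMod 2) : Function.Bijective f ↔ f 0 ≠ f 1 := by
  revert f
  change ∀ f : Fin 2 → Fin 2, Function.Bijective f ↔ f 0 ≠ f 1
  decide

lemma par_aux (s : ℕ → ℕ) (k : ℕ) :
    Function.Bijective (fun j : Fin 2 => ((s (k * 2 + j.val) : ℕ) : ZMod 2)) ↔
      s (2 * k) % 2 ≠ s (2 * k + 1) % 2 := by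
  rw [bij_aux]
  simp only [ne_eq, ZMod.natCast_eq_natCast_iff, Nat.ModEq, mul_comm k 2]
  rfl

lemma inf_aux (G : AddSubmonoid ℕ) (hG : ((G : Set ℕ)ᶜ).Finite) :
    (Set.ofPred fun x => x ∈ G ∧ 0 < x).Infinite := by
  have h : ((G : Set ℕ) \ {0}).Infinite :=
    Set.Infinite.sdiff (by simpa using hG.infinite_compl) (Set.finite_singleton 0)
  refine h.mono ?_
  rintro x ⟨h1, h2⟩
  exact ⟨h1, Nat.pos_of_ne_zero h2⟩

lemma img_aux (s : ℕ → ℕ) : s '' Set.Iio 2 = {s 0, s 1} := by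
  ext x
  constructor
  · rintro ⟨i, hi, rfl⟩
    have : i < 2 := hi
    interval_cases i <;> simp
  · rintro (rfl | rfl)
    · exact ⟨0, by simp, rfl⟩
    · exact ⟨1, by simp, rfl⟩

lemma c12 (x : ℕ) : x ∈ AddSubmonoid.closure ({1, 2} : Set ℕ) := by
  rw [AddSubmonoid.mem_closure_pair]
  exact ⟨x, 0, by simp⟩

lemma c23 (x : ℕ) : x ∈ AddSubmonoid.closure ({2, 3} : Set ℕ) ↔ x = 0 ∨ 2 ≤ x := by
  rw [AddSubmonoid.mem_closure_pair]
  simp only [smul_eq_mul]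
  constructor
  · rintro ⟨m, n, h⟩; omega
  · intro h
    rcases Nat.even_or_odd' x with ⟨k, rfl | rfl⟩
    · exact ⟨k, 0, by omega⟩
    · exact ⟨k - 1, 1, by omega⟩

lemma c34 (x : ℕ) : x ∈ AddSubmonoid.closure ({3, 4} : Set ℕ) ↔
    x = 0 ∨ x = 3 ∨ x = 4 ∨ 6 ≤ x := by
  rw [AddSubmonoid.mem_closure_pair]
  simp only [smul_eq_mul]
  constructor
  · rintro ⟨m, n, h⟩
    rcases m with _ | _ | m <;> rcases n with _ | _ | n <;> omega
  · intro h
    exact ⟨x / 3 - x % 3, x % 3, by omega⟩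

lemma build_aux (G : AddSubmonoid ℕ) (hG : ((G : Set ℕ)ᶜ).Finite) (s : ℕ → ℕ)
    (h0 : s 0 ∈ G ∧ 0 < s 0) (h0' : ∀ z, z < s 0 → ¬ (z ∈ G ∧ 0 < z))
    (hs : ∀ n, s n < s (n + 1)) (hm : ∀ n, s (n + 1) ∈ G)
    (hno : ∀ n z, s n < z → z < s (n + 1) → ¬ z ∈ G)
    (hgen : G = AddSubmonoid.closure {s 0, s 1})
    (hpar : ∀ k, s (2 * k) % 2 ≠ s (2 * k + 1) % 2) : IsPermutationSemigroup 2 G := by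
  have key : ∀ n, posSeq G n = s n := by
    intro n
    induction n with
    | zero => exact zero_aux (inf_aux G hG) h0 h0'
    | succ n ih =>
      exact step_aux (inf_aux G hG) ih (hs n) ⟨hm n, by have := hs n; omega⟩
        (fun z h1 h2 h3 => hno n z h1 h2 h3.1)
  refine ⟨hG, ?_, ?_⟩
  · rw [img_aux, key, key]; exact hgen
  · intro k
    rw [par_aux, key, key]; exact hpar k

lemma dvd_aux (G : AddSubmonoid ℕ) (hG : ((G : Set ℕ)ᶜ).Finite) (d a b : ℕ)
    (hmem : ∀ z, z ∈ G ↔ ∃ i j, i * a + j * b = z) (ha : d ∣ a) (hb : d ∣ b) : d = 1 := by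
  obtain ⟨N, hN⟩ := hG.bddAbove
  have hd : ∀ z, N < z → d ∣ z := by
    intro z hz
    have : z ∈ G := by
      by_contra hc
      have := hN (show z ∈ ((G : Set ℕ)ᶜ) from hc)
      omega
    obtain ⟨i, j, rfl⟩ := (hmem z).1 this
    exact dvd_add (ha.mul_left i) (hb.mul_left j)
  have h1 := hd (N + 1) (by omega)
  have h2 := hd (N + 1 + 1) (by omega)
  exact Nat.dvd_one.1 ((Nat.dvd_add_right h1).1 h2)

lemma split_aux (i a : ℕ) : i * a = 0 ∧ i = 0 ∨ i * a = a ∧ i = 1 ∨ i * a = 2 * a ∧ i = 2 ∨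
    i * a = 3 * a ∧ i = 3 ∨ 4 * a ≤ i * a := by
  rcases i with _ | _ | _ | _ | i
  · simp
  · simp
  · simp
  · simp
  · right; right; right; right
    exact Nat.mul_le_mul_right a (by omega)

set_option maxHeartbeats 2000000 in
lemma forward_aux (G : AddSubmonoid ℕ) (hG : ((G : Set ℕ)ᶜ).Finite)
    (h : IsPermutationSemigroup 2 G) : ∃ a b, G = AddSubmonoid.closure {a, b} ∧
      (a = 1 ∧ b = 2 ∨ a = 2 ∧ b = 3 ∨ a = 3 ∧ b = 4) := by
  obtain ⟨-, hgen, hbij⟩ := h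
  have hinf := inf_aux G hG
  have hpar : ∀ k, posSeq G (2 * k) % 2 ≠ posSeq G (2 * k + 1) % 2 :=
    fun k => (par_aux _ k).1 (hbij k)
  rw [img_aux] at hgen
  obtain ⟨a, ha⟩ : ∃ a, posSeq G 0 = a := ⟨_, rfl⟩
  obtain ⟨b, hb⟩ : ∃ b, posSeq G 1 = b := ⟨_, rfl⟩
  rw [ha, hb] at hgen
  refine ⟨a, b, hgen, ?_⟩
  have hmem : ∀ z, z ∈ G ↔ ∃ i j, i * a + j * b = z := by
    intro z
    conv_lhs => rw [hgen]
    rw [AddSubmonoid.mem_closure_pair]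
    simp only [smul_eq_mul]
  have hapos : 0 < a := by
    have := (Nat.nth_mem_of_infinite hinf 0).2
    change 0 < posSeq G 0 at this
    omega
  have hab : a < b := by
    have : posSeq G 0 < posSeq G 1 := Nat.nth_strictMono hinf Nat.zero_lt_one
    omega
  have st : ∀ n x y, posSeq G n = x → x < y → (∃ i j, i * a + j * b = y) →
      (∀ i j, x < i * a + j * b → i * a + j * b < y → False) → posSeq G (n + 1) = y := by
    intro n x y h1 h2 h3 h4
    refine step_aux hinf h1 h2 ⟨(hmem y).2 h3, by omega⟩ ?_
    rintro z hz1 hz2 ⟨hz3, -⟩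
    obtain ⟨i, j, rfl⟩ := (hmem z).1 hz3
    exact h4 i j hz1 hz2
  have hb2 : b ≤ 2 * a := by
    by_contra hc
    have h2 : posSeq G 1 = 2 * a := by
      refine st 0 a (2 * a) ha (by omega) ⟨2, 0, by omega⟩ ?_
      intro i j h1 h2
      rcases split_aux i a with h | h | h | h | h <;>
      rcases split_aux j b with h' | h' | h' | h' | h' <;> omega
    omega
  have p0 : a % 2 ≠ b % 2 := by
    have := hpar 0
    simpa [ha, hb] using this
  by_cases ha3 : a < 3
  · omega
  have hb2' : b ≠ 2 * a := by
    rintro rfl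
    have := dvd_aux G hG a a _ hmem dvd_rfl (Dvd.intro_left 2 rfl)
    omega
  have h32 : 2 * b ≠ 3 * a := by
    intro hc
    have := dvd_aux G hG (a / 2) a b hmem ⟨2, by omega⟩ ⟨3, by omega⟩
    omega
  by_cases h43 : 3 * b = 4 * a
  · have := dvd_aux G hG (a / 3) a b hmem ⟨3, by omega⟩ ⟨4, by omega⟩
    omega
  exfalso
  have s2 : posSeq G 2 = 2 * a := by
    refine st 1 b _ hb (by omega) ⟨2, 0, by omega⟩ ?_
    intro i j h1 h2
    rcases split_aux i a with h | h | h | h | h <;>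
    rcases split_aux j b with h' | h' | h' | h' | h' <;> omega
  have s3 : posSeq G 3 = a + b := by
    refine st 2 _ _ s2 (by omega) ⟨1, 1, by omega⟩ ?_
    intro i j h1 h2
    rcases split_aux i a with h | h | h | h | h <;>
    rcases split_aux j b with h' | h' | h' | h' | h' <;> omega
  have q2 := hpar 2
  have q3 := hpar 3
  have q4 := hpar 4
  norm_num at q2 q3 q4
  rcases Nat.lt_or_gt_of_ne h32 with hlt | hgt
  · have s4 : posSeq G 4 = 2 * b := by
      refine st 3 _ _ s3 (by omega) ⟨0, 2, by omega⟩ ?_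
      intro i j h1 h2
      rcases split_aux i a with h | h | h | h | h <;>
      rcases split_aux j b with h' | h' | h' | h' | h' <;> omega
    have s5 : posSeq G 5 = 3 * a := by
      refine st 4 _ _ s4 (by omega) ⟨3, 0, by omega⟩ ?_
      intro i j h1 h2
      rcases split_aux i a with h | h | h | h | h <;>
      rcases split_aux j b with h' | h' | h' | h' | h' <;> omega
    have s6 : posSeq G 6 = 2 * a + b := by
      refine st 5 _ _ s5 (by omega) ⟨2, 1, by omega⟩ ?_
      intro i j h1 h2
      rcases split_aux i a with h | h | h | h | h <;>
      rcases split_aux j b with h' | h' | h' | h' | h' <;> omega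
    have s7 : posSeq G 7 = a + 2 * b := by
      refine st 6 _ _ s6 (by omega) ⟨1, 2, by omega⟩ ?_
      intro i j h1 h2
      rcases split_aux i a with h | h | h | h | h <;>
      rcases split_aux j b with h' | h' | h' | h' | h' <;> omega
    rcases Nat.lt_or_gt_of_ne h43 with hl | hg
    · have s8 : posSeq G 8 = 3 * b := by
        refine st 7 _ _ s7 (by omega) ⟨0, 3, by omega⟩ ?_
        intro i j h1 h2
        rcases split_aux i a with h | h | h | h | h <;>
        rcases split_aux j b with h' | h' | h' | h' | h' <;> omega
      have s9 : posSeq G 9 = 4 * a := by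
        refine st 8 _ _ s8 (by omega) ⟨4, 0, by omega⟩ ?_
        intro i j h1 h2
        rcases split_aux i a with h | h | h | h | h <;>
        rcases split_aux j b with h' | h' | h' | h' | h' <;> omega
      omega
    · have s8 : posSeq G 8 = 4 * a := by
        refine st 7 _ _ s7 (by omega) ⟨4, 0, by omega⟩ ?_
        intro i j h1 h2
        rcases split_aux i a with h | h | h | h | h <;>
        rcases split_aux j b with h' | h' | h' | h' | h' <;> omega
      have s9 : posSeq G 9 = 3 * b := by
        refine st 8 _ _ s8 (by omega) ⟨0, 3, by omega⟩ ?_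
        intro i j h1 h2
        have hi : i ≤ 4 ∨ 5 * a ≤ i * a := by
          rcases Nat.lt_or_ge 4 i with hi | hi
          · exact Or.inr (Nat.mul_le_mul_right a hi)
          · exact Or.inl hi
        rcases hi with hi | hi
        · interval_cases i <;> rcases split_aux j b with h' | h' | h' | h' | h' <;> omega
        · rcases split_aux j b with h' | h' | h' | h' | h' <;> omega
      omega
  · have s4 : posSeq G 4 = 3 * a := by
      refine st 3 _ _ s3 (by omega) ⟨3, 0, by omega⟩ ?_
      intro i j h1 h2
      rcases split_aux i a with h | h | h | h | h <;>
      rcases split_aux j b with h' | h' | h' | h' | h' <;> omega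
    have s5 : posSeq G 5 = 2 * b := by
      refine st 4 _ _ s4 (by omega) ⟨0, 2, by omega⟩ ?_
      intro i j h1 h2
      rcases split_aux i a with h | h | h | h | h <;>
      rcases split_aux j b with h' | h' | h' | h' | h' <;> omega
    have s6 : posSeq G 6 = 2 * a + b := by
      refine st 5 _ _ s5 (by omega) ⟨2, 1, by omega⟩ ?_
      intro i j h1 h2
      rcases split_aux i a with h | h | h | h | h <;>
      rcases split_aux j b with h' | h' | h' | h' | h' <;> omega
    have s7 : posSeq G 7 = 4 * a := by
      refine st 6 _ _ s6 (by omega) ⟨4, 0, by omega⟩ ?_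
      intro i j h1 h2
      rcases split_aux i a with h | h | h | h | h <;>
      rcases split_aux j b with h' | h' | h' | h' | h' <;> omega
    omega

theorem two_permutation_classification :
    (∀ G : AddSubmonoid ℕ, ((G : Set ℕ)ᶜ).Finite →
      (IsPermutationSemigroup 2 G ↔
        G = AddSubmonoid.closure ({1, 2} : Set ℕ) ∨
        G = AddSubmonoid.closure ({2, 3} : Set ℕ) ∨
        G = AddSubmonoid.closure ({3, 4} : Set ℕ))) ∧
    (AddSubmonoid.closure ({1, 2} : Set ℕ) : Set ℕ) = Set.univ ∧
    (AddSubmonoid.closure ({2, 3} : Set ℕ) : Set ℕ) = {0} ∪ {x : ℕ | 2 ≤ x} ∧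
    (AddSubmonoid.closure ({3, 4} : Set ℕ) : Set ℕ) = {0, 3, 4} ∪ {x : ℕ | 6 ≤ x} := by
  refine ⟨?_, ?_, ?_, ?_⟩
  · intro G hG
    constructor
    · intro h
      obtain ⟨a, b, hg, ⟨rfl, rfl⟩ | ⟨rfl, rfl⟩ | ⟨rfl, rfl⟩⟩ := forward_aux G hG h
      · exact Or.inl hg
      · exact Or.inr (Or.inl hg)
      · exact Or.inr (Or.inr hg)
    · rintro (rfl | rfl | rfl)
      · refine build_aux _ hG (fun n => n + 1) ⟨c12 _, by simp⟩ ?_ ?_ ?_ ?_ ?_ ?_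
        · intro z hz; omega
        · intro n; simp
        · intro n; exact c12 _
        · intro n z h1 h2; omega
        · rfl
        · intro k; omega
      · refine build_aux _ hG (fun n => n + 2) ⟨by simp [c23], by simp⟩ ?_ ?_ ?_ ?_ ?_ ?_
        · intro z hz; rw [c23]; omega
        · intro n; simp
        · intro n; rw [c23]; omega
        · intro n z h1 h2; omega
        · rfl
        · intro k; omega
      · refine build_aux _ hG (fun n => if n < 2 then n + 3 else n + 4)
          ⟨by simp [c34], by simp⟩ ?_ ?_ ?_ ?_ ?_ ?_
        · intro z hz; simp at hz; rw [c34]; omega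
        · intro n; split_ifs <;> omega
        · intro n; rw [c34]; split_ifs <;> omega
        · intro n z h1 h2; rw [c34]; split_ifs at h1 h2 <;> omega
        · rfl
        · intro k; split_ifs <;> omega
  · ext x; simp [c12]
  · ext x; simp [c23]
  · ext x; simp [c34, or_assoc]
end

section
/- Let a_0, e, k be positive integers and let S = {a_0, a_0 + e, a_0 + 2e, …, a_0 + ke} be an arithmetic progression. Then a natural number x belongs to the submonoid ⟨S⟩ of (ℕ, +, 0) generated by S if and only if x = a_0·q + e·r for some natural numbers q, r with 0 ≤ r ≤ k·q. Moreover, if gcd(a_0, e) = 1 (so that ⟨S⟩ is a numerical semigroup), the Frobenius number of ⟨S⟩, i.e. the largest integer not in ⟨S⟩, equals a_0·⌊(a_0 − 2)/k⌋ + e·(a_0 − 1). -/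
theorem arith_seq_mem_aux (a0 e k : ℕ) (x : ℕ) :
      x ∈ AddSubmonoid.closure {y : ℕ | ∃ i ≤ k, y = a0 + i * e} ↔
        ∃ q r : ℕ, r ≤ k * q ∧ x = a0 * q + e * r := by
  constructor
  · intro h
    induction h using AddSubmonoid.closure_induction with
    | mem y hy =>
      obtain ⟨i, hi, rfl⟩ := hy
      exact ⟨1, i, by simpa using hi, by ring⟩
    | zero => exact ⟨0, 0, by simp, by simp⟩
    | add y z _ _ h1 h2 =>
      obtain ⟨q, r, h, rfl⟩ := h1
      obtain ⟨q', r', h', rfl⟩ := h2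
      exact ⟨q + q', r + r', by rw [mul_add]; omega, by ring⟩
  · rintro ⟨q, r, h, rfl⟩
    induction q generalizing r with
    | zero =>
      have : r = 0 := by simpa using h
      subst this
      simp
    | succ q ih =>
      obtain ⟨i, j, hi, hj, rfl⟩ : ∃ i j, i ≤ k ∧ j ≤ k * q ∧ r = i + j := by
        rw [mul_add] at h
        exact ⟨min r k, r - min r k, by omega, by omega, by omega⟩
      have h1 := ih j hj
      have h2 : a0 + i * e ∈ AddSubmonoid.closure {y : ℕ | ∃ i ≤ k, y = a0 + i * e} :=
        AddSubmonoid.subset_closure ⟨i, hi, rfl⟩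
      have h3 := add_mem h1 h2
      convert h3 using 1
      ring

theorem arith_seq_membership_and_frobenius (a0 e k : ℕ)
    (ha0 : 0 < a0) (he : 0 < e) (hk : 0 < k) :
    (∀ x : ℕ,
      x ∈ AddSubmonoid.closure {y : ℕ | ∃ i ≤ k, y = a0 + i * e} ↔
        ∃ q r : ℕ, r ≤ k * q ∧ x = a0 * q + e * r) ∧
    (Nat.gcd a0 e = 1 → 2 ≤ a0 →
      IsGreatest {x : ℕ | x ∉ AddSubmonoid.closure {y : ℕ | ∃ i ≤ k, y = a0 + i * e}}
        (a0 * ((a0 - 2) / k) + e * (a0 - 1))) := by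
  refine ⟨arith_seq_mem_aux a0 e k, fun hg h2 => ⟨?_, ?_⟩⟩
  · rw [Set.mem_setOf_eq, arith_seq_mem_aux]
    rintro ⟨q, r, hr, h⟩
    have hm : k * ((a0 - 2) / k) ≤ a0 - 2 := Nat.mul_div_le _ _
    generalize (a0 - 2) / k = m at *
    have hmod : e * r ≡ e * (a0 - 1) [MOD a0] := by
      have : (a0 * m + e * (a0 - 1)) % a0 = (a0 * q + e * r) % a0 := by rw [h]
      simpa [Nat.ModEq, Nat.mul_add_mod] using this.symm
    have hmod2 : r ≡ a0 - 1 [MOD a0] := Nat.ModEq.cancel_left_of_coprime hg hmod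
    have hge : a0 - 1 ≤ r := by
      have h1 : r % a0 = a0 - 1 := by
        rw [hmod2, Nat.mod_eq_of_lt (by omega)]
      rw [← h1]; exact Nat.mod_le _ _
    have h3 : e * (a0 - 1) ≤ e * r := Nat.mul_le_mul_left _ hge
    have h4 : q ≤ m := Nat.le_of_mul_le_mul_left (by omega : a0 * q ≤ a0 * m) ha0
    have h5 : k * q ≤ k * m := Nat.mul_le_mul_left _ h4
    omega
  · intro x hx
    rw [Set.mem_setOf_eq, arith_seq_mem_aux] at hx
    by_contra hlt
    apply hx
    push Not at hlt
    have hm : a0 - 2 < k * ((a0 - 2) / k + 1) := by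
      have := Nat.lt_mul_div_succ (a0 - 2) hk
      simpa using this
    generalize (a0 - 2) / k = m at *
    obtain ⟨y, hy1, hy2⟩ := Nat.chineseRemainder hg x 0
    obtain ⟨s, rfl⟩ := (Nat.modEq_zero_iff_dvd.mp hy2)
    have hr : s % a0 < a0 := Nat.mod_lt _ ha0
    have hmod : e * (s % a0) ≡ x [MOD a0] :=
      ((Nat.mod_modEq s a0).mul_left e).trans hy1
    generalize s % a0 = r at *
    have h1 : e * r ≤ e * (a0 - 1) := Nat.mul_le_mul_left _ (by omega)
    obtain ⟨q, hq⟩ := (Nat.modEq_iff_dvd' (by omega)).mp hmod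
    have h3 : m < q := Nat.lt_of_mul_lt_mul_left (by omega : a0 * m < a0 * q)
    have h4 : k * (m + 1) ≤ k * q := Nat.mul_le_mul_left _ h3
    exact ⟨q, r, by omega, by omega⟩
end

section
/- For every positive integer k, the numerical semigroup generated by S = {3k, 3k+1, 6k−1} is a 3-permutation numerical semigroup. -/
/-- Explicit membership description. -/
def Fam (k x : ℕ) : Prop := ∃ m : ℕ, m * (3 * k) ≤ x + m / 2 ∧ x ≤ m * (3 * k) + m

theorem fam_mem (k : ℕ) (hk : 0 < k) (x : ℕ) :
    x ∈ AddSubmonoid.closure ({3 * k, 3 * k + 1, 6 * k - 1} : Set ℕ) ↔ Fam k x := by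
  constructor
  · intro h
    induction h using AddSubmonoid.closure_induction with
    | mem x hx =>
      simp only [Set.mem_insert_iff, Set.mem_singleton_iff] at hx
      rcases hx with h | h | h
      · exact ⟨1, by omega, by omega⟩
      · exact ⟨1, by omega, by omega⟩
      · exact ⟨2, by omega, by omega⟩
    | zero => exact ⟨0, by simp, by simp⟩
    | add x y _ _ hx hy =>
      obtain ⟨m, h1, h2⟩ := hx
      obtain ⟨m', h3, h4⟩ := hy
      refine ⟨m + m', ?_, ?_⟩
      · rw [add_mul]; omega
      · rw [add_mul]; omega
  · rintro ⟨m, h1, h2⟩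
    have ha : 3 * k ∈ AddSubmonoid.closure ({3 * k, 3 * k + 1, 6 * k - 1} : Set ℕ) :=
      AddSubmonoid.subset_closure (by simp)
    have hb : 3 * k + 1 ∈ AddSubmonoid.closure ({3 * k, 3 * k + 1, 6 * k - 1} : Set ℕ) :=
      AddSubmonoid.subset_closure (by simp)
    have hc : 6 * k - 1 ∈ AddSubmonoid.closure ({3 * k, 3 * k + 1, 6 * k - 1} : Set ℕ) :=
      AddSubmonoid.subset_closure (by simp)
    rcases le_total (m * (3 * k)) x with h | h
    · obtain ⟨y, rfl⟩ := Nat.exists_eq_add_of_le h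
      obtain ⟨d, rfl⟩ : ∃ d, m = y + d := Nat.exists_eq_add_of_le (by omega)
      have := add_mem (nsmul_mem ha d) (nsmul_mem hb y)
      convert this using 1
      simp only [smul_eq_mul]; ring
    · obtain ⟨z, hz⟩ := Nat.exists_eq_add_of_le h
      obtain ⟨d, rfl⟩ : ∃ d, m = 2 * z + d := Nat.exists_eq_add_of_le (by omega)
      have := add_mem (nsmul_mem ha d) (nsmul_mem hc z)
      convert this using 1
      simp only [smul_eq_mul]
      obtain ⟨c, hc⟩ : ∃ c, 6 * k = c + 1 := ⟨6 * k - 1, by omega⟩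
      rw [hc, Nat.add_sub_cancel]
      have : (2 * z + d) * (3 * k) = z * (6 * k) + d * (3 * k) := by ring
      rw [this, hc, mul_add] at hz
      omega

theorem fam_gap (k : ℕ) (hk : 0 < k) (m x : ℕ) (h1 : m * (3 * k) + m < x)
    (h2 : x + (m + 1) / 2 < (m + 1) * (3 * k)) : ¬ Fam k x := by
  rintro ⟨n, h3, h4⟩
  rcases Nat.lt_or_ge m n with h | h
  · obtain ⟨d, rfl⟩ : ∃ d, n = m + 1 + d := Nat.exists_eq_add_of_le (by omega)
    have : d ≤ d * (3 * k) := Nat.le_mul_of_pos_right _ (by omega)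
    rw [add_mul (m + 1) d] at h3
    omega
  · have := Nat.mul_le_mul_right (3 * k) h
    omega

theorem fam_large (k : ℕ) (hk : 0 < k) (x : ℕ) (hx : (2 * k - 1) * (3 * k) ≤ x + (k - 1)) :
    Fam k x := by
  have hd := Nat.div_add_mod x (3 * k)
  have hr := Nat.mod_lt x (show 0 < 3 * k by omega)
  generalize x / (3 * k) = m at *
  generalize x % (3 * k) = r at *
  rw [mul_comm] at hd
  have e1 : (m + 1) * (3 * k) = m * (3 * k) + 3 * k := by ring
  by_cases h : r ≤ m
  · exact ⟨m, by omega, by omega⟩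
  · refine ⟨m + 1, ?_, by omega⟩
    rcases Nat.lt_or_ge m (2 * k - 1) with h' | h'
    · have h3 : m + 1 = 2 * k - 1 := by
        by_contra hne
        have : m + 2 ≤ 2 * k - 1 := by omega
        have := Nat.mul_le_mul_right (3 * k) this
        have e2 : (m + 2) * (3 * k) = m * (3 * k) + 6 * k := by ring
        omega
      rw [h3] at *
      omega
    · omega

theorem count_next (p : ℕ → Prop) [DecidablePred p] (x y : ℕ) (hx : p x) (hxy : x < y)
    (h : ∀ z, x < z → z < y → ¬ p z) : Nat.count p y = Nat.count p x + 1 := by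
  induction y, hxy using Nat.le_induction with
  | base => simp [Nat.count_succ, hx]
  | succ y hy ih =>
    rw [Nat.count_succ, ih (fun z h1 h2 => h z h1 (by omega)), if_neg (h y hy (by omega))]

/-- `i`-th element of block `q`. -/
def blk (k q i : ℕ) : ℕ :=
  ((2 * q + 1) * (3 * k) - q + i) + if i < 3 * q + 2 then 0 else 3 * (k - (q + 1))

theorem blk_mem (k q i : ℕ) (hq : q + 1 ≤ k) (hi : i < 6 * (q + 1) ∨ q + 1 = k) :
    Fam k (blk k q i) := by
  have hle : q ≤ (2 * q + 1) * (3 * k) := by nlinarith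
  unfold blk
  by_cases hk : q + 1 = k
  · apply fam_large k (by omega)
    have : 2 * k - 1 = 2 * q + 1 := by omega
    rw [this]
    omega
  · have e1 : (2 * q + 2) * (3 * k) = (2 * q + 1) * (3 * k) + 3 * k := by ring
    split_ifs with h
    · exact ⟨2 * q + 1, by omega, by omega⟩
    · exact ⟨2 * q + 2, by omega, by omega⟩

theorem blk_step (k q i : ℕ) (hq : q + 1 ≤ k) (p : ℕ → Prop) [DecidablePred p]
    (hp : ∀ x, p x ↔ Fam k x ∧ 0 < x)
    (hi : i + 1 < 6 * (q + 1) ∨ q + 1 = k) :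
    Nat.count p (blk k q (i + 1)) = Nat.count p (blk k q i) + 1 := by
  have hle : q < (2 * q + 1) * (3 * k) := by nlinarith
  apply count_next
  · rw [hp]
    refine ⟨blk_mem k q i hq (by omega), ?_⟩
    unfold blk; omega
  · unfold blk; split_ifs <;> omega
  · intro z h1 h2
    rw [hp]
    rintro ⟨h3, -⟩
    have e1 : (2 * q + 1 + 1) * (3 * k) = (2 * q + 1) * (3 * k) + 3 * k := by ring
    refine fam_gap k (by omega) (2 * q + 1) z ?_ ?_ h3 <;>
    · unfold blk at h1 h2; split_ifs at h1 h2 <;> omega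

theorem blk_next (k q : ℕ) (hq : q + 2 ≤ k) (p : ℕ → Prop) [DecidablePred p]
    (hp : ∀ x, p x ↔ Fam k x ∧ 0 < x) :
    Nat.count p (blk k (q + 1) 0) = Nat.count p (blk k q (6 * q + 5)) + 1 := by
  have hle : q < (2 * q + 1) * (3 * k) := by nlinarith
  have e1 : (2 * q + 2) * (3 * k) = (2 * q + 1) * (3 * k) + 3 * k := by ring
  have e2 : (2 * (q + 1) + 1) * (3 * k) = (2 * q + 1) * (3 * k) + 6 * k := by ring
  have e3 : (2 * q + 2 + 1) * (3 * k) = (2 * q + 1) * (3 * k) + 6 * k := by ring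
  apply count_next
  · rw [hp]
    refine ⟨blk_mem k q _ (by omega) (by omega), ?_⟩
    unfold blk; omega
  · unfold blk; split_ifs <;> omega
  · intro z h1 h2
    rw [hp]
    rintro ⟨h3, -⟩
    refine fam_gap k (by omega) (2 * q + 2) z ?_ ?_ h3 <;>
    · unfold blk at h1 h2; split_ifs at h1 h2 <;> omega

theorem blk_count (k q i : ℕ) (hq : q + 1 ≤ k) (p : ℕ → Prop) [DecidablePred p]
    (hp : ∀ x, p x ↔ Fam k x ∧ 0 < x) (hi : i < 6 * (q + 1) ∨ q + 1 = k) :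
    Nat.count p (blk k q i) = 3 * (q * (q + 1)) + i := by
  induction q generalizing i with
  | zero =>
    induction i with
    | zero =>
      rw [Nat.count_eq_card_filter_range]
      simp only [Nat.zero_mul, Nat.mul_zero, Nat.add_zero, Finset.card_eq_zero,
        Finset.filter_eq_empty_iff, Finset.mem_range]
      intro x hx
      rw [hp]
      rintro ⟨h, h0⟩
      refine fam_gap k (by omega) 0 x (by omega) ?_ h
      simp [blk] at hx ⊢
      omega
    | succ i ih => rw [blk_step k 0 i hq p hp hi, ih (by omega)]; rfl
  | succ q ihq =>
    induction i with
    | zero =>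
      rw [blk_next k q hq p hp, ihq _ (by omega) (by omega)]; ring
    | succ i ih => rw [blk_step k _ i hq p hp hi, ih (by omega)]; rfl

theorem blk_decomp (k : ℕ) (hk : 0 < k) (t : ℕ) :
    ∃ q r, t = q * (q + 1) + r ∧ q + 1 ≤ k ∧ (r < 2 * (q + 1) ∨ q + 1 = k) := by
  induction t with
  | zero => exact ⟨0, 0, by simp, by omega, by omega⟩
  | succ t ih =>
    obtain ⟨q, r, h1, h2, h3⟩ := ih
    by_cases h : r + 1 < 2 * (q + 1) ∨ q + 1 = k
    · exact ⟨q, r + 1, by omega, h2, h⟩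
    · refine ⟨q + 1, 0, ?_, by omega, by omega⟩
      have : r = 2 * q + 1 := by omega
      subst this
      rw [h1]; ring

theorem posSeq_blk (k q i : ℕ) (hq : q + 1 ≤ k) (hi : i < 6 * (q + 1) ∨ q + 1 = k) :
    posSeq (AddSubmonoid.closure ({3 * k, 3 * k + 1, 6 * k - 1} : Set ℕ))
      (3 * (q * (q + 1)) + i) = blk k q i := by
  classical
  unfold posSeq
  have hp : ∀ x, (x ∈ AddSubmonoid.closure ({3 * k, 3 * k + 1, 6 * k - 1} : Set ℕ) ∧ 0 < x)
      ↔ Fam k x ∧ 0 < x := fun x => by rw [fam_mem k (by omega)]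
  rw [← blk_count k q i hq _ hp hi]
  apply Nat.nth_count
  rw [hp]
  refine ⟨blk_mem k q i hq hi, ?_⟩
  have hle : q < (2 * q + 1) * (3 * k) := by nlinarith
  unfold blk; omega

theorem blk_mod (k q i : ℕ) : blk k q i % 3 = (blk k q 0 + i) % 3 := by
  unfold blk; split_ifs <;> omega

theorem family1_is_three_permutation (k : ℕ) (hk : 0 < k) :
    IsPermutationSemigroup 3 (AddSubmonoid.closure ({3 * k, 3 * k + 1, 6 * k - 1} : Set ℕ)) := by
  refine ⟨?_, ?_, ?_⟩
  · refine (Set.finite_Iio ((2 * k - 1) * (3 * k))).subset ?_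
    intro x hx
    by_contra h
    apply hx
    simp only [Set.mem_Iio, not_lt] at h
    exact (fam_mem k hk x).2 (fam_large k hk x (by omega))
  · have h0 := posSeq_blk k 0 0 (by omega) (by omega)
    have h1 := posSeq_blk k 0 1 (by omega) (by omega)
    have h2 := posSeq_blk k 0 2 (by omega) (by omega)
    simp only [blk, Nat.zero_mul, Nat.mul_zero, Nat.zero_add] at h0 h1 h2
    have hI : (Set.Iio 3 : Set ℕ) = {0, 1, 2} := by
      ext x; simp only [Set.mem_Iio, Set.mem_insert_iff, Set.mem_singleton_iff]; omega
    rw [hI, Set.image_insert_eq, Set.image_insert_eq, Set.image_singleton, h0, h1, h2]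
    congr 1
    have e : 6 * k - 1 = 1 * (3 * k) - 0 + 2 + 3 * (k - 1) := by omega
    rw [e]
    simp
  · intro t
    obtain ⟨q, r, h1, h2, h3⟩ := blk_decomp k hk t
    have key : ∀ j : Fin 3, posSeq (AddSubmonoid.closure ({3 * k, 3 * k + 1, 6 * k - 1} : Set ℕ))
        (t * 3 + j.val) = blk k q (3 * r + j.val) := by
      intro j
      rw [← posSeq_blk k q (3 * r + j.val) h2 (by omega)]
      congr 1
      omega
    have hinj : Function.Injective (fun j : Fin 3 =>
        ((posSeq (AddSubmonoid.closure ({3 * k, 3 * k + 1, 6 * k - 1} : Set ℕ))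
          (t * 3 + j.val) : ℕ) : ZMod 3)) := by
      intro a b hab
      simp only [key] at hab
      rw [ZMod.natCast_eq_natCast_iff, Nat.ModEq, blk_mod, blk_mod k q (3 * r + b.val)] at hab
      ext
      omega
    rw [Fintype.bijective_iff_injective_and_card]
    exact ⟨hinj, by simp [ZMod.card]⟩
end

section
/- For every positive integer k, the numerical semigroup generated by S = {3k, 3k+1, 6k−1} equals the set ⋃_{i∈ℕ} (A_i ∪ B_i), where A_i = {x ∈ ℕ : (2i)·3k − i ≤ x ≤ (2i)·3k + 2i} and B_i = {x ∈ ℕ : (2i+1)·3k − i ≤ x ≤ (2i+1)·3k + 2i + 1}. -/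
/-- Elements of the closure are those within the window of some weight `n`. -/
lemma mem_closure_iff_window (k : ℕ) (hk : 0 < k) (x : ℕ) :
    x ∈ AddSubmonoid.closure ({3 * k, 3 * k + 1, 6 * k - 1} : Set ℕ) ↔
      ∃ n : ℕ, n * (3 * k) ≤ x + n / 2 ∧ x ≤ n * (3 * k) + n := by
  constructor
  · intro h
    induction h using AddSubmonoid.closure_induction with
    | mem y hy =>
      simp only [Set.mem_insert_iff, Set.mem_singleton_iff] at hy
      rcases hy with rfl | rfl | rfl
      · exact ⟨1, by omega, by omega⟩
      · exact ⟨1, by omega, by omega⟩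
      · exact ⟨2, by omega, by omega⟩
    | zero => exact ⟨0, by omega, by omega⟩
    | add a b _ _ ha hb =>
      obtain ⟨n, h1, h2⟩ := ha
      obtain ⟨p, h3, h4⟩ := hb
      refine ⟨n + p, ?_, ?_⟩ <;> rw [add_mul] <;> omega
  · rintro ⟨n, h1, h2⟩
    have key : ∀ a b c : ℕ, a * (3 * k) + b * (3 * k + 1) + c * (6 * k - 1) ∈
        AddSubmonoid.closure ({3 * k, 3 * k + 1, 6 * k - 1} : Set ℕ) := by
      intro a b c
      have hg : ∀ (t g : ℕ), g ∈ ({3 * k, 3 * k + 1, 6 * k - 1} : Set ℕ) →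
          t * g ∈ AddSubmonoid.closure ({3 * k, 3 * k + 1, 6 * k - 1} : Set ℕ) := by
        intro t g hg
        have := AddSubmonoid.nsmul_mem _ (AddSubmonoid.subset_closure hg) t
        simpa only [smul_eq_mul] using this
      exact add_mem (add_mem (hg _ _ (by simp)) (hg _ _ (by simp))) (hg _ _ (by simp))
    obtain ⟨q, hq⟩ : ∃ q, 6 * k - 1 = q := ⟨_, rfl⟩
    have hq' : q + 1 = 2 * (3 * k) := by omega
    rcases le_total (n * (3 * k)) x with h | h
    · obtain ⟨j, rfl⟩ := Nat.exists_eq_add_of_le h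
      obtain ⟨a, rfl⟩ := Nat.exists_eq_add_of_le (show j ≤ n by omega)
      convert key a j 0 using 1
      ring
    · obtain ⟨c, hc⟩ := Nat.exists_eq_add_of_le h
      obtain ⟨a, rfl⟩ := Nat.exists_eq_add_of_le (show 2 * c ≤ n by omega)
      convert key a 0 c using 1
      rw [hq]
      have : c * (q + 1) = c * (2 * (3 * k)) := by rw [hq']
      linarith

theorem closure_eq_union_intervals (k : ℕ) (hk : 0 < k) :
    (AddSubmonoid.closure ({3 * k, 3 * k + 1, 6 * k - 1} : Set ℕ) : Set ℕ) =
      ⋃ i : ℕ,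
        (Set.Icc ((2 * i) * (3 * k) - i) ((2 * i) * (3 * k) + 2 * i) ∪
         Set.Icc ((2 * i + 1) * (3 * k) - i) ((2 * i + 1) * (3 * k) + 2 * i + 1)) := by
  ext x
  rw [SetLike.mem_coe, mem_closure_iff_window k hk]
  simp only [Set.mem_iUnion, Set.mem_union, Set.mem_Icc]
  constructor
  · rintro ⟨n, h1, h2⟩
    obtain ⟨i, rfl | rfl⟩ := Nat.even_or_odd' n
    · exact ⟨i, Or.inl ⟨by omega, by omega⟩⟩
    · exact ⟨i, Or.inr ⟨by omega, by omega⟩⟩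
  · rintro ⟨i, ⟨h1, h2⟩ | ⟨h1, h2⟩⟩
    · exact ⟨2 * i, by omega, by omega⟩
    · exact ⟨2 * i + 1, by omega, by omega⟩
end

section
/- For every positive integer k, the numerical semigroup generated by S = {6k+1, 6k+2, 9k+3} is a 3-permutation numerical semigroup. -/
/-- The offsets `e` of elements `3kd+e` of degree `d`. -/
def OffOK (d e : ℕ) : Prop := d ≤ 2 * e ∧ e ≤ d ∧ (d % 2 = 1 → d + 3 ≤ 2 * e)

abbrev GG (k : ℕ) : AddSubmonoid ℕ :=
  AddSubmonoid.closure ({6 * k + 1, 6 * k + 2, 9 * k + 3} : Set ℕ)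

lemma mem_GG_iff (k x : ℕ) : x ∈ GG k ↔ ∃ d e, OffOK d e ∧ x = 3 * k * d + e := by
  constructor
  · intro h
    induction h using AddSubmonoid.closure_induction with
    | mem x hx =>
      rcases hx with rfl | rfl | rfl
      · exact ⟨2, 1, by unfold OffOK; omega, by ring⟩
      · exact ⟨2, 2, by unfold OffOK; omega, by ring⟩
      · exact ⟨3, 3, by unfold OffOK; omega, by ring⟩
    | zero => exact ⟨0, 0, by unfold OffOK; omega, by ring⟩
    | add x y _ _ hx hy =>
      obtain ⟨d, e, h, rfl⟩ := hx
      obtain ⟨d', e', h', rfl⟩ := hy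
      exact ⟨d + d', e + e', by unfold OffOK at *; omega, by ring⟩
  · rintro ⟨d, e, ⟨h1, h2, h3⟩, rfl⟩
    have g1 : 6 * k + 1 ∈ GG k := AddSubmonoid.subset_closure (by simp)
    have g2 : 6 * k + 2 ∈ GG k := AddSubmonoid.subset_closure (by simp)
    have g3 : 9 * k + 3 ∈ GG k := AddSubmonoid.subset_closure (by simp)
    have key : ∀ a b : ℕ, a * (6 * k + 1) + b * (6 * k + 2) ∈ GG k := fun a b =>
      add_mem (by simpa using nsmul_mem g1 a) (by simpa using nsmul_mem g2 b)
    rcases Nat.even_or_odd' d with ⟨m, rfl | rfl⟩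
    · obtain ⟨b, rfl⟩ : ∃ b, e = m + b := ⟨e - m, by omega⟩
      obtain ⟨a, rfl⟩ : ∃ a, m = a + b := ⟨m - b, by omega⟩
      convert key a b using 1
      ring
    · have h3' := h3 (by omega)
      obtain ⟨n, rfl⟩ : ∃ n, m = n + 1 := ⟨m - 1, by omega⟩
      obtain ⟨b, rfl⟩ : ∃ b, e = n + 3 + b := ⟨e - (n + 3), by omega⟩
      obtain ⟨a, rfl⟩ : ∃ a, n = a + b := ⟨n - b, by omega⟩
      convert add_mem (key a b) g3 using 1
      ring

lemma nth_succ_eq {p : ℕ → Prop} (hp : (Set.ofPred p).Infinite) {n x y : ℕ}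
    (hx : Nat.nth p n = x) (hy : p y) (hxy : x < y) (hb : ∀ z, x < z → z < y → ¬ p z) :
    Nat.nth p (n + 1) = y := by
  classical
  have hm := Nat.nth_count hy
  have h1 : n < Nat.count p y := by
    rw [← (Nat.nth_strictMono hp).lt_iff_lt, hm, hx]; exact hxy
  have h2 : Nat.nth p (n + 1) ≤ y := by
    rw [← hm]; exact (Nat.nth_strictMono hp).monotone h1
  have h3 : x < Nat.nth p (n + 1) := by
    rw [← hx]; exact Nat.nth_strictMono hp (Nat.lt_succ_self n)
  by_contra hne
  exact hb _ h3 (lt_of_le_of_ne h2 hne) (Nat.nth_mem_of_infinite hp _)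

lemma nth_zero_eq {p : ℕ → Prop} (hp : (Set.ofPred p).Infinite) {y : ℕ}
    (hy : p y) (hb : ∀ z, z < y → ¬ p z) :
    Nat.nth p 0 = y := by
  classical
  have hm := Nat.nth_count hy
  have h2 : Nat.nth p 0 ≤ y := by
    rw [← hm]; exact (Nat.nth_strictMono hp).monotone (Nat.zero_le _)
  by_contra hne
  exact hb _ (lt_of_le_of_ne h2 hne) (Nat.nth_mem_of_infinite hp _)

/-- first offset of degree `d` -/
def st (d : ℕ) : ℕ := if d % 2 = 1 then (d + 3) / 2 else d / 2

lemma offOK_iff (d e : ℕ) : OffOK d e ↔ st d ≤ e ∧ e ≤ d := by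
  unfold OffOK st
  split_ifs <;> omega

lemma no_between (k d z : ℕ) (hk : 0 < k) (h1 : 3 * k * d + d < z)
    (h2 : z < 3 * k * (d + 1) + st (d + 1)) : z ∉ GG k := by
  rw [mem_GG_iff]
  rintro ⟨d', e', h, rfl⟩
  rw [offOK_iff] at h
  rcases lt_or_ge d d' with hd | hd
  · rcases eq_or_lt_of_le (Nat.succ_le_of_lt hd) with h' | h'
    · subst h'
      simp only [Nat.succ_eq_add_one] at *
      omega
    · obtain ⟨c, rfl⟩ : ∃ c, d' = d + 2 + c := ⟨d' - (d + 2), by omega⟩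
      have : st (d + 1) ≤ st (d + 2 + c) + 3 := by unfold st; split_ifs <;> omega
      have h5 : 3 * k * (d + 2 + c) = 3 * k * (d + 1) + 3 * k + 3 * k * c := by ring
      have : st (d + 1) ≤ st (d + 2 + c) + 3 * k + 3 * k * c := by omega
      omega
  · have : 3 * k * d' ≤ 3 * k * d := Nat.mul_le_mul_left _ hd
    omega

lemma tail_mem (k x : ℕ) (hk : 0 < k) (hx : 3 * k * (6 * k + 1) + st (6 * k + 1) ≤ x) :
    x ∈ GG k := by
  rw [mem_GG_iff]
  suffices h : ∃ d e, 6 * k + 1 ≤ d ∧ OffOK d e ∧ x = 3 * k * d + e by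
    obtain ⟨d, e, _, h⟩ := h
    exact ⟨d, e, h⟩
  induction x, hx using Nat.le_induction with
  | base =>
    exact ⟨6 * k + 1, st (6 * k + 1), le_rfl,
      by unfold OffOK st; split_ifs <;> omega, rfl⟩
  | succ x _ ih =>
    obtain ⟨d, e, hd, h, rfl⟩ := ih
    by_cases he : e < d
    · exact ⟨d, e + 1, hd, by unfold OffOK at *; omega, by ring⟩
    · refine ⟨d + 1, d + 1 - 3 * k, by omega, by unfold OffOK at *; omega, ?_⟩
      have : 3 * k * (d + 1) = 3 * k * d + 3 * k := by ring
      unfold OffOK at h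
      omega

/-- Block-start invariant. -/
def BInv (k x : ℕ) : Prop :=
  3 * k * (6 * k + 1) + st (6 * k + 1) ≤ x ∨
  ∃ d e, 2 ≤ d ∧ d ≤ 6 * k ∧ st d ≤ e ∧ e ≤ d ∧ x = 3 * k * d + e ∧
    ((d % 3 = 1 ∧ e % 3 = 2) ∨ (d % 3 ≠ 1 ∧ e % 3 = 1))

/-- `y` is the next element after `x`. -/
def Nxt (k x y : ℕ) : Prop := (y ∈ GG k ∧ 0 < y) ∧ x < y ∧ ∀ z, x < z → z < y → ¬ (z ∈ GG k ∧ 0 < z)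

lemma nxt_succ (k x : ℕ) (h : x + 1 ∈ GG k) : Nxt k x (x + 1) :=
  ⟨⟨h, by omega⟩, by omega, fun z _ _ => by omega⟩

lemma nxt_in (k d e : ℕ) (h1 : st d ≤ e) (h2 : e < d) :
    Nxt k (3 * k * d + e) (3 * k * d + (e + 1)) :=
  nxt_succ k _ ((mem_GG_iff _ _).2 ⟨d, e + 1, (offOK_iff _ _).2 (by omega), by ring⟩)

lemma nxt_jump (k d : ℕ) (hk : 0 < k) (h1 : 2 ≤ d) (h2 : d ≤ 6 * k) :
    Nxt k (3 * k * d + d) (3 * k * (d + 1) + st (d + 1)) := by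
  have h5 : 3 * k * (d + 1) = 3 * k * d + 3 * k := by ring
  have h6 : d < 3 * k + st (d + 1) := by unfold st; split_ifs <;> omega
  refine ⟨⟨(mem_GG_iff _ _).2 ⟨d + 1, st (d + 1), (offOK_iff _ _).2 ⟨le_rfl, ?_⟩, rfl⟩, by omega⟩,
    by omega, fun z hz hz' h => no_between k d z hk hz hz' h.1⟩
  unfold st; split_ifs <;> omega

lemma step (k x : ℕ) (hk : 0 < k) (h : BInv k x) :
    ∃ y z w, Nxt k x y ∧ Nxt k y z ∧ Nxt k z w ∧ BInv k w ∧
      x % 3 ≠ y % 3 ∧ x % 3 ≠ z % 3 ∧ y % 3 ≠ z % 3 := by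
  rcases h with h | ⟨d, e, hd2, hd, hs, he, rfl, hm⟩
  · refine ⟨x + 1, x + 1 + 1, x + 1 + 1 + 1, nxt_succ _ _ (tail_mem _ _ hk (by omega)),
      nxt_succ _ _ (tail_mem _ _ hk (by omega)), nxt_succ _ _ (tail_mem _ _ hk (by omega)),
      Or.inl (by omega), by omega, by omega, by omega⟩
  have m1 : ∀ d e, (3 * k * d + e) % 3 = e % 3 := fun d e => by
    rw [mul_assoc, Nat.mul_add_mod]
  have hst : ∀ d, st d % 3 = (2 * d) % 3 := fun d => by unfold st; split_ifs <;> omega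
  have s1 := hst (d + 1)
  have hlt : ∀ d, 2 ≤ d → st d ≤ d := fun d => by unfold st; split_ifs <;> omega
  have hlt1 : ∀ d, 4 ≤ d → st d < d := fun d => by unfold st; split_ifs <;> omega
  -- invariant at a jump
  have inv1 : ∀ e', st (d + 1) ≤ e' → e' ≤ d + 1 →
     (((d + 1) % 3 = 1 ∧ e' % 3 = 2) ∨ ((d + 1) % 3 ≠ 1 ∧ e' % 3 = 1)) →
      BInv k (3 * k * (d + 1) + e') := by
    intro e' a b c
    by_cases hdd : d + 1 ≤ 6 * k
    · exact Or.inr ⟨d + 1, e', by omega, hdd, a, b, rfl, c⟩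
    · have : d = 6 * k := by omega
      subst this
      exact Or.inl (by omega)
  by_cases c1 : e + 2 < d
  · refine ⟨_, _, _, nxt_in k d e hs (by omega), nxt_in k d (e + 1) (by omega) (by omega),
      nxt_in k d (e + 1 + 1) (by omega) (by omega),
      Or.inr ⟨d, e + 1 + 1 + 1, hd2, hd, by omega, by omega, rfl, by omega⟩, ?_⟩
    simp only [m1]; omega
  by_cases c2 : e + 2 = d
  · have n3 := nxt_jump k d hk hd2 hd
    rw [show 3 * k * d + d = 3 * k * d + (e + 1 + 1) by omega] at n3
    refine ⟨_, _, _, nxt_in k d e hs (by omega), nxt_in k d (e + 1) (by omega) (by omega), n3,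
      inv1 _ le_rfl (hlt _ (by omega)) (by omega), ?_⟩
    simp only [m1]; omega
  by_cases c3 : e + 1 = d
  · -- d % 3 = 2
    have n2 := nxt_jump k d hk hd2 hd
    rw [show 3 * k * d + d = 3 * k * d + (e + 1) by omega] at n2
    by_cases c4 : d = 2
    · subst c4
      have n3 := nxt_jump k 3 hk (by omega) (by omega)
      have e3 : st (2 + 1) = 3 := by decide
      have e4 : st (3 + 1) = 2 := by decide
      refine ⟨_, _, 3 * k * (3 + 1) + st (3 + 1), nxt_in k 2 e hs (by omega), n2, ?_, ?_, ?_⟩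
      · rw [e3]; exact n3
      · exact Or.inr ⟨4, 2, by omega, by omega, by decide, by omega, by rw [e4], by omega⟩
      · simp only [m1]; omega
    · refine ⟨_, _, _, nxt_in k d e hs (by omega), n2,
        nxt_in k (d + 1) _ le_rfl (hlt1 _ (by omega)),
        inv1 _ (by omega) (hlt1 _ (by omega)) (by omega), ?_⟩
      simp only [m1]; omega
  · exfalso; omega

theorem family2_is_three_permutation (k : ℕ) (hk : 0 < k) :
    IsPermutationSemigroup 3 (AddSubmonoid.closure ({6 * k + 1, 6 * k + 2, 9 * k + 3} : Set ℕ)) := by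
  change IsPermutationSemigroup 3 (GG k)
  have hfin : ((GG k : Set ℕ)ᶜ).Finite := by
    refine (Set.finite_Iio (3 * k * (6 * k + 1) + st (6 * k + 1))).subset fun x hx => ?_
    by_contra h
    exact hx (tail_mem k x hk (by simpa using h))
  have hinf : (Set.ofPred (fun x => x ∈ GG k ∧ 0 < x)).Infinite := by
    refine (Set.Ioi_infinite (3 * k * (6 * k + 1) + st (6 * k + 1))).mono fun x hx => ?_
    have hx' : _ < x := hx
    exact ⟨tail_mem k x hk hx'.le, by omega⟩
  have nx : ∀ {n x y}, posSeq (GG k) n = x → Nxt k x y → posSeq (GG k) (n + 1) = y :=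
    fun h h' => nth_succ_eq hinf h h'.1 h'.2.1 h'.2.2
  have s2 : st 2 = 1 := by decide
  have s3 : st 3 = 3 := by decide
  have p0 : posSeq (GG k) 0 = 3 * k * 2 + 1 := by
    refine nth_zero_eq hinf ⟨(mem_GG_iff _ _).2 ⟨2, 1, by unfold OffOK; omega, rfl⟩, by omega⟩ ?_
    rintro z hz ⟨hz', h0⟩
    obtain ⟨d, e, h, rfl⟩ := (mem_GG_iff _ _).1 hz'
    unfold OffOK at h
    rcases Nat.lt_or_ge d 2 with hd | hd
    · interval_cases d <;> omega
    · have : 3 * k * 2 ≤ 3 * k * d := Nat.mul_le_mul_left _ hd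
      omega
  refine ⟨hfin, ?_, ?_⟩
  · have p1 := nx p0 (nxt_in k 2 1 (by omega) (by omega))
    have p2 := nx p1 (nxt_jump k 2 hk (by omega) (by omega))
    have : posSeq (GG k) '' Set.Iio 3 = {6 * k + 1, 6 * k + 2, 9 * k + 3} := by
      have h3 : Set.Iio 3 = ({0, 1, 2} : Set ℕ) := by ext x; simp; omega
      rw [h3, Set.image_insert_eq, Set.image_insert_eq, Set.image_singleton, p0]
      simp only [zero_add, Nat.reduceAdd] at p1 p2
      rw [p1, p2, s3]
      congr 1
      · omega
      · congr 1
        · omega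
        · congr 1
          omega
    rw [this]
  · have inv : ∀ j, BInv k (posSeq (GG k) (j * 3)) := by
      intro j
      induction j with
      | zero =>
        rw [zero_mul, p0]
        exact Or.inr ⟨2, 1, by omega, by omega, by omega, by omega, rfl, by omega⟩
      | succ j ih =>
        obtain ⟨y, z, w, h1, h2, h3, h4, -⟩ := step k _ hk ih
        have := nx (nx (nx rfl h1) h2) h3
        rw [show (j + 1) * 3 = j * 3 + 1 + 1 + 1 by ring, this]
        exact h4
    intro j
    obtain ⟨y, z, w, h1, h2, h3, h4, a1, a2, a3⟩ := step k _ hk (inv j)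
    have q1 := nx rfl h1
    have q2 := nx q1 h2
    rw [← q2] at a2 a3
    rw [← q1] at a1 a3
    rw [Fintype.bijective_iff_injective_and_card]
    refine ⟨?_, by simp [ZMod.card]⟩
    intro u v huv
    have huv' := (ZMod.natCast_eq_natCast_iff' _ _ _).1 huv
    fin_cases u <;> fin_cases v <;> simp [add_assoc] at huv' a1 a2 a3 ⊢ <;> omega
end

section
/- For every positive integer k, the numerical semigroup generated by S = {6k+1, 9k+2, 9k+3} is a 3-permutation numerical semigroup. -/
namespace Fam3

/-- explicit description of the elements of the semigroup -/
def P (k n : ℕ) : Prop :=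
  ∃ t d, (n = (6 * k + 1) * t + d ∧ d ≤ 3 * (t / 3)) ∨
    (1 ≤ t ∧ n = (6 * k + 1) * t + 3 * k + 1 + d ∧ d ≤ 3 * ((t - 1) / 3) + 1)

lemma mem_raw (k n : ℕ) :
    n ∈ AddSubmonoid.closure ({6 * k + 1, 9 * k + 2, 9 * k + 3} : Set ℕ) ↔
      ∃ x y z, n = x * (6 * k + 1) + y * (9 * k + 2) + z * (9 * k + 3) := by
  constructor
  · intro h
    induction h using AddSubmonoid.closure_induction with
    | mem x hx =>
      rcases hx with rfl | rfl | rfl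
      · exact ⟨1, 0, 0, by ring⟩
      · exact ⟨0, 1, 0, by ring⟩
      · exact ⟨0, 0, 1, by ring⟩
    | zero => exact ⟨0, 0, 0, by ring⟩
    | add a b _ _ ha hb =>
      obtain ⟨x, y, z, rfl⟩ := ha
      obtain ⟨x', y', z', rfl⟩ := hb
      exact ⟨x + x', y + y', z + z', by ring⟩
  · rintro ⟨x, y, z, rfl⟩
    have h1 : 6 * k + 1 ∈ AddSubmonoid.closure ({6 * k + 1, 9 * k + 2, 9 * k + 3} : Set ℕ) :=
      AddSubmonoid.subset_closure (by simp)
    have h2 : 9 * k + 2 ∈ AddSubmonoid.closure ({6 * k + 1, 9 * k + 2, 9 * k + 3} : Set ℕ) :=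
      AddSubmonoid.subset_closure (by simp)
    have h3 : 9 * k + 3 ∈ AddSubmonoid.closure ({6 * k + 1, 9 * k + 2, 9 * k + 3} : Set ℕ) :=
      AddSubmonoid.subset_closure (by simp)
    have := add_mem (add_mem (nsmul_mem h1 x) (nsmul_mem h2 y)) (nsmul_mem h3 z)
    simpa only [smul_eq_mul] using this

lemma mem_iff (k n : ℕ) :
    n ∈ AddSubmonoid.closure ({6 * k + 1, 9 * k + 2, 9 * k + 3} : Set ℕ) ↔ P k n := by
  rw [mem_raw]
  constructor
  · rintro ⟨x, y, z, rfl⟩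
    obtain ⟨j, hj | hj⟩ : ∃ j, y + z = 2 * j ∨ y + z = 2 * j + 1 := ⟨(y + z) / 2, by omega⟩
    · refine ⟨x + 3 * j, j + z, Or.inl ⟨?_, by omega⟩⟩
      zify at hj ⊢
      have : (y : ℤ) = 2 * j - z := by linarith
      rw [this]; ring
    · refine ⟨x + 3 * j + 1, j + z, Or.inr ⟨by omega, ?_, by omega⟩⟩
      zify at hj ⊢
      have : (y : ℤ) = 2 * j + 1 - z := by linarith
      rw [this]; ring
  · rintro ⟨t, d, ⟨rfl, h⟩ | ⟨ht, rfl, h⟩⟩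
    · obtain ⟨j, hj⟩ : ∃ j, j = (d + 2) / 3 := ⟨_, rfl⟩
      obtain ⟨x, hx⟩ : ∃ x, t = x + 3 * j := ⟨t - 3 * j, by omega⟩
      obtain ⟨y, hy⟩ : ∃ y, y + d = 3 * j := ⟨3 * j - d, by omega⟩
      obtain ⟨z, hz⟩ : ∃ z, d = z + j := ⟨d - j, by omega⟩
      refine ⟨x, y, z, ?_⟩
      zify at hx hy hz ⊢
      have : (y : ℤ) = 2 * j - z := by linarith
      rw [this, hx, hz]; ring
    · obtain ⟨j, hj⟩ : ∃ j, j = (d + 1) / 3 := ⟨_, rfl⟩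
      obtain ⟨x, hx⟩ : ∃ x, t = x + 3 * j + 1 := ⟨t - 3 * j - 1, by omega⟩
      obtain ⟨y, hy⟩ : ∃ y, y + d = 3 * j + 1 := ⟨3 * j + 1 - d, by omega⟩
      obtain ⟨z, hz⟩ : ∃ z, d = z + j := ⟨d - j, by omega⟩
      refine ⟨x, y, z, ?_⟩
      zify at hx hy hz ⊢
      have : (y : ℤ) = 2 * j + 1 - z := by linarith
      rw [this, hx, hz]; ring

lemma P_large (k n : ℕ) (h : (6 * k + 1) * (3 * k + 1) ≤ n) : P k n := by
  have h1 := Nat.div_add_mod n (6 * k + 1)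
  have h2 := Nat.mod_lt n (show 0 < 6 * k + 1 by omega)
  have h3 : 3 * k + 1 ≤ n / (6 * k + 1) := by
    rw [Nat.le_div_iff_mul_le (by omega)]; linarith
  generalize n / (6 * k + 1) = t at *
  generalize n % (6 * k + 1) = r at *
  by_cases hr : r ≤ 3 * (t / 3)
  · exact ⟨t, r, Or.inl ⟨h1.symm, hr⟩⟩
  · exact ⟨t, r - (3 * k + 1), Or.inr ⟨by omega, by omega, by omega⟩⟩

lemma gap1 (k t u : ℕ) (hk : 0 < k) (hu : P k u)
    (h : (6 * k + 1) * t + 3 * (t / 3) < u) : (6 * k + 1) * t + 3 * k + 1 ≤ u := by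
  obtain ⟨s, d, ⟨rfl, hd⟩ | ⟨hs, rfl, hd⟩⟩ := hu
  · rcases Nat.lt_or_ge t s with hl | hl
    · have := Nat.mul_le_mul_left (6 * k + 1) hl
      rw [Nat.mul_succ] at this
      omega
    · have := Nat.mul_le_mul_left (6 * k + 1) hl
      omega
  · rcases Nat.lt_or_ge s t with hl | hl
    · have := Nat.mul_le_mul_left (6 * k + 1) hl
      rw [Nat.mul_succ] at this
      omega
    · have := Nat.mul_le_mul_left (6 * k + 1) hl
      omega

lemma gap2 (k t u : ℕ) (hk : 0 < k) (hu : P k u)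
    (h : (6 * k + 1) * t + 3 * k + 1 + 3 * ((t - 1) / 3) + 1 < u) :
    (6 * k + 1) * (t + 1) ≤ u := by
  obtain ⟨s, d, ⟨rfl, hd⟩ | ⟨hs, rfl, hd⟩⟩ := hu
  · rcases Nat.lt_or_ge t s with hl | hl
    · have := Nat.mul_le_mul_left (6 * k + 1) hl
      rw [Nat.succ_eq_add_one] at this
      omega
    · have := Nat.mul_le_mul_left (6 * k + 1) hl
      omega
  · rcases Nat.lt_or_ge t s with hl | hl
    · have := Nat.mul_le_mul_left (6 * k + 1) hl
      rw [Nat.succ_eq_add_one] at this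
      omega
    · have := Nat.mul_le_mul_left (6 * k + 1) hl
      omega

def Nx (k x y : ℕ) : Prop := P k y ∧ x < y ∧ ∀ u, P k u → x < u → y ≤ u

/-- block starts -/
def B (k x : ℕ) : Prop :=
  (∃ t i, 1 ≤ t ∧ t ≤ 3 * k ∧ 3 * i ≤ t ∧ x = (6 * k + 1) * t + 3 * i) ∨
  (∃ t i, t ≤ 3 * k ∧ 3 * i + 4 ≤ t ∧ x = (6 * k + 1) * t + 3 * k + 3 + 3 * i) ∨
  (6 * k + 1) * (3 * k + 1) ≤ x

lemma nx_succ (k x y : ℕ) (h : P k y) (hy : y = x + 1) : Nx k x y :=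
  ⟨h, by omega, fun _ _ _ => by omega⟩

lemma P_even (k t : ℕ) (d : ℕ) (hd : d ≤ 3 * (t / 3)) : P k ((6 * k + 1) * t + d) :=
  ⟨t, d, Or.inl ⟨rfl, hd⟩⟩

lemma P_odd (k t : ℕ) (d n : ℕ) (ht : 1 ≤ t) (hd : d ≤ 3 * ((t - 1) / 3) + 1)
    (hn : n = (6 * k + 1) * t + 3 * k + 1 + d) : P k n :=
  ⟨t, d, Or.inr ⟨ht, hn, hd⟩⟩

lemma nx_odd (k t x : ℕ) (hk : 0 < k) (h1 : 1 ≤ t) (h2 : t ≤ 3 * k)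
    (hx : x = (6 * k + 1) * t + 3 * (t / 3)) : Nx k x ((6 * k + 1) * t + 3 * k + 1) :=
  ⟨P_odd k t 0 _ h1 (by omega) rfl, by omega, fun u hu hxu => gap1 k t u hk hu (by omega)⟩

lemma nx_even (k t x : ℕ) (hk : 0 < k) (h1 : 1 ≤ t) (h2 : t ≤ 3 * k)
    (hx : x = (6 * k + 1) * t + 3 * k + 1 + 3 * ((t - 1) / 3) + 1) :
    Nx k x ((6 * k + 1) * (t + 1)) :=
  ⟨P_even k (t + 1) 0 (by omega), by rw [Nat.mul_succ]; omega,
    fun u hu hxu => gap2 k t u hk hu (by omega)⟩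

lemma B_even (k t : ℕ) : t ≤ 3 * k → B k ((6 * k + 1) * (t + 1)) := by
  intro h
  rcases Nat.lt_or_ge t (3 * k) with h' | h'
  · exact Or.inl ⟨t + 1, 0, by omega, by omega, by omega, rfl⟩
  · have : t = 3 * k := by omega
    subst this
    exact Or.inr (Or.inr le_rfl)

lemma step (k x : ℕ) (hk : 0 < k) (hB : B k x) :
    ∃ y z w, Nx k x y ∧ Nx k y z ∧ Nx k z w ∧ B k w ∧
      y % 3 = (x + 1) % 3 ∧ z % 3 = (x + 2) % 3 := by
  rcases hB with ⟨t, i, h1, h2, h3, rfl⟩ | ⟨t, i, h2, h3, rfl⟩ | h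
  · by_cases h : 3 * i + 3 ≤ t
    · refine ⟨_, _, _, nx_succ k _ _ (P_even k t (3 * i + 1) (by omega)) (by omega),
        nx_succ k _ _ (P_even k t (3 * i + 2) (by omega)) (by omega),
        nx_succ k _ _ (P_even k t (3 * (i + 1)) (by omega)) (by omega),
        Or.inl ⟨t, i + 1, h1, h2, by omega, rfl⟩, by omega, by omega⟩
    · have a1 := nx_odd k t ((6 * k + 1) * t + 3 * i) hk h1 h2 (by omega)
      have a2 := nx_succ k ((6 * k + 1) * t + 3 * k + 1) ((6 * k + 1) * t + 3 * k + 2)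
        (P_odd k t 1 _ h1 (by omega) (by omega)) (by omega)
      by_cases ht : 4 ≤ t
      · refine ⟨_, _, _, a1, a2, nx_succ k _ ((6 * k + 1) * t + 3 * k + 3 + 3 * 0)
          (P_odd k t 2 _ h1 (by omega) (by omega)) (by omega),
          Or.inr (Or.inl ⟨t, 0, h2, by omega, rfl⟩), by omega, by omega⟩
      · exact ⟨_, _, _, a1, a2, nx_even k t _ hk h1 h2 (by omega), B_even k t h2,
          by omega, by omega⟩
  · have a1 := nx_succ k ((6 * k + 1) * t + 3 * k + 3 + 3 * i)
      ((6 * k + 1) * t + 3 * k + 4 + 3 * i)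
      (P_odd k t (3 * i + 3) _ (by omega) (by omega) (by omega)) (by omega)
    have a2 := nx_succ k ((6 * k + 1) * t + 3 * k + 4 + 3 * i)
      ((6 * k + 1) * t + 3 * k + 5 + 3 * i)
      (P_odd k t (3 * i + 4) _ (by omega) (by omega) (by omega)) (by omega)
    by_cases ht : 3 * (i + 1) + 4 ≤ t
    · exact ⟨_, _, _, a1, a2, nx_succ k _ ((6 * k + 1) * t + 3 * k + 3 + 3 * (i + 1))
        (P_odd k t (3 * i + 5) _ (by omega) (by omega) (by omega)) (by omega),
        Or.inr (Or.inl ⟨t, i + 1, h2, ht, rfl⟩), by omega, by omega⟩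
    · exact ⟨_, _, _, a1, a2, nx_even k t _ hk (by omega) h2 (by omega), B_even k t h2,
        by omega, by omega⟩
  · exact ⟨x + 1, x + 2, x + 3, nx_succ k _ _ (P_large k _ (by omega)) rfl,
      nx_succ k _ _ (P_large k _ (by omega)) rfl, nx_succ k _ _ (P_large k _ (by omega)) rfl,
      Or.inr (Or.inr (by omega)), rfl, rfl⟩

lemma infP (k : ℕ) : {x | P k x ∧ 0 < x}.Infinite := by
  apply Set.infinite_of_not_bddAbove
  rintro ⟨b, hb⟩
  have : b + 1 + (6 * k + 1) * (3 * k + 1) ≤ b :=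
    hb ⟨P_large k _ (by omega), by omega⟩
  omega

lemma nth_next (k m y : ℕ) (h : Nx k (Nat.nth (fun x => P k x ∧ 0 < x) m) y) :
    Nat.nth (fun x => P k x ∧ 0 < x) (m + 1) = y := by
  obtain ⟨h1, h2, h3⟩ := h
  have hlt := (Nat.nth_lt_nth (infP k)).2 (Nat.lt_succ_self m)
  have hm := Nat.nth_mem_of_infinite (infP k) (m + 1)
  apply le_antisymm
  · obtain ⟨j, -, hj⟩ := Nat.exists_lt_card_nth_eq (p := fun x => P k x ∧ 0 < x)
      (x := y) ⟨h1, by omega⟩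
    rw [← hj] at h2 ⊢
    rw [Nat.nth_lt_nth (infP k)] at h2
    exact (Nat.nth_le_nth (infP k)).2 h2
  · exact h3 _ hm.1 hlt

lemma nth_zero (k : ℕ) (hk : 0 < k) :
    Nat.nth (fun x => P k x ∧ 0 < x) 0 = (6 * k + 1) * 1 := by
  have hP : P k ((6 * k + 1) * 1) := P_even k 1 0 (by omega)
  apply le_antisymm
  · obtain ⟨j, -, hj⟩ := Nat.exists_lt_card_nth_eq (p := fun x => P k x ∧ 0 < x)
      (x := (6 * k + 1) * 1) ⟨hP, by omega⟩
    rw [← hj]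
    exact (Nat.nth_le_nth (infP k)).2 (Nat.zero_le _)
  · have hm := Nat.nth_mem_of_infinite (infP k) 0
    exact gap2 k 0 _ hk hm.1 (by
      have h0 := gap1 k 0 _ hk hm.1 (by simpa using hm.2)
      obtain ⟨s, d, ⟨h, hd⟩ | ⟨hs, h, hd⟩⟩ := hm.1
      · rcases Nat.eq_zero_or_pos s with rfl | hs
        · omega
        · have := Nat.mul_le_mul_left (6 * k + 1) hs
          omega
      · have := Nat.mul_le_mul_left (6 * k + 1) hs
        omega)

lemma block (k : ℕ) (hk : 0 < k) (n : ℕ) :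
    B k (Nat.nth (fun x => P k x ∧ 0 < x) (n * 3)) := by
  induction n with
  | zero =>
    rw [Nat.zero_mul, nth_zero k hk]
    exact Or.inl ⟨1, 0, le_rfl, by omega, by omega, rfl⟩
  | succ n ih =>
    obtain ⟨y, z, w, h1, h2, h3, hB, -, -⟩ := step k _ hk ih
    have e1 := nth_next k _ _ h1
    rw [← e1] at h2
    have e2 := nth_next k _ _ h2
    rw [← e2] at h3
    have e3 := nth_next k _ _ h3
    rw [show (n + 1) * 3 = n * 3 + 1 + 1 + 1 by ring, e3]
    exact hB

end Fam3

theorem family3_is_three_permutation (k : ℕ) (hk : 0 < k) :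
    IsPermutationSemigroup 3 (AddSubmonoid.closure ({6 * k + 1, 9 * k + 2, 9 * k + 3} : Set ℕ)) := by
  have hseq : posSeq (AddSubmonoid.closure ({6 * k + 1, 9 * k + 2, 9 * k + 3} : Set ℕ)) =
      Nat.nth (fun x => Fam3.P k x ∧ 0 < x) := by
    unfold posSeq
    congr 1
    funext x
    rw [Fam3.mem_iff]
  refine ⟨?_, ?_, ?_⟩
  · apply (Set.finite_Iio ((6 * k + 1) * (3 * k + 1))).subset
    intro x hx
    by_contra hlt
    exact hx ((Fam3.mem_iff k x).2 (Fam3.P_large k x (by simpa using hlt)))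
  · rw [hseq]
    have e0 := Fam3.nth_zero k hk
    have h1 := Fam3.nx_odd k 1 ((6 * k + 1) * 1) hk le_rfl (by omega) (by omega)
    rw [← e0] at h1
    have e1 := Fam3.nth_next k 0 _ h1
    have h2 := Fam3.nx_succ k ((6 * k + 1) * 1 + 3 * k + 1) (9 * k + 3)
      (Fam3.P_odd k 1 1 _ le_rfl (by omega) (by omega)) (by omega)
    rw [e0] at e1
    rw [← e1] at h2
    have e2 := Fam3.nth_next k 1 _ h2
    congr 1
    have hI : Set.Iio 3 = ({0, 1, 2} : Set ℕ) := by
      ext x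
      simp only [Set.mem_Iio, Set.mem_insert_iff, Set.mem_singleton_iff]
      omega
    have e1' : Nat.nth (fun x => Fam3.P k x ∧ 0 < x) 1 = 9 * k + 2 := by
      rw [show (1 : ℕ) = 0 + 1 from rfl]
      omega
    have e2' : Nat.nth (fun x => Fam3.P k x ∧ 0 < x) 2 = 9 * k + 3 := e2
    rw [hI, Set.image_insert_eq, Set.image_insert_eq, Set.image_singleton, e0, e1', e2', mul_one]
  · intro n
    rw [hseq]
    obtain ⟨y, z, w, h1, h2, -, -, r1, r2⟩ := Fam3.step k _ hk (Fam3.block k hk n)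
    have e1 := Fam3.nth_next k _ _ h1
    rw [← e1] at h2
    have e2 := Fam3.nth_next k _ _ h2
    rw [← e1] at r1
    rw [← e2] at r2
    rw [Fintype.bijective_iff_injective_and_card]
    refine ⟨?_, by simp⟩
    intro i j hij
    simp only [ZMod.natCast_eq_natCast_iff'] at hij
    fin_cases i <;> fin_cases j <;> simp [add_assoc] at hij r1 r2 ⊢ <;> omega
end

section
/- For every integer k ≥ 2, the numerical semigroup generated by S = {6k+1, 12k−4, 12k} is a 3-permutation numerical semigroup. -/
open Classical in
/-- Elements of residue `r` mod 3 satisfying `P` below `N`. -/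
noncomputable def rcount (P : ℕ → Prop) (N r : ℕ) : ℕ :=
  Nat.count (fun x => P x ∧ x % 3 = r % 3) N

open Classical in
lemma rcount_succ (P : ℕ → Prop) (N r : ℕ) :
    rcount P (N + 1) r = rcount P N r + if P N ∧ N % 3 = r % 3 then 1 else 0 := by
  unfold rcount
  rw [Nat.count_succ]

lemma rcount_succ_of (P : ℕ → Prop) (N r : ℕ) (hP : P N) (c : Prop) [Decidable c]
    (hc : N % 3 = r % 3 ↔ c) :
    rcount P (N + 1) r = rcount P N r + if c then 1 else 0 := by
  rw [rcount_succ]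
  by_cases h : c
  · rw [if_pos h, if_pos ⟨hP, hc.2 h⟩]
  · rw [if_neg h, if_neg (fun h' => h (hc.1 h'.2))]

lemma rcount_succ_not (P : ℕ → Prop) (N r : ℕ) (hP : ¬ P N) :
    rcount P (N + 1) r = rcount P N r := by
  rw [rcount_succ, if_neg (fun h => hP h.1)]
  rfl

lemma rcount_congr (P : ℕ → Prop) (N r r' : ℕ) (h : r % 3 = r' % 3) :
    rcount P N r = rcount P N r' := by
  unfold rcount; rw [h]

open Classical in
lemma rcount_sum (P : ℕ → Prop) (N : ℕ) :
    rcount P N 0 + rcount P N 1 + rcount P N 2 = Nat.count P N := by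
  induction N with
  | zero => simp [rcount]
  | succ N ih =>
    rw [rcount_succ, rcount_succ, rcount_succ, Nat.count_succ]
    by_cases hP : P N
    · have : N % 3 = 0 ∨ N % 3 = 1 ∨ N % 3 = 2 := by omega
      rcases this with h | h | h <;> simp [hP, h] <;> omega
    · simp [hP]; omega

open Classical in
lemma exists_of_rcount_lt (P : ℕ → Prop) (M N r : ℕ) (h : rcount P M r < rcount P N r) :
    ∃ x, M ≤ x ∧ x < N ∧ P x ∧ x % 3 = r % 3 := by
  by_contra hc
  push Not at hc
  have : ∀ d, M + d ≤ N → rcount P (M + d) r = rcount P M r := by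
    intro d
    induction d with
    | zero => simp
    | succ d ih =>
      intro hd
      rw [← add_assoc, rcount_succ, ih (by omega), if_neg]
      · rfl
      · rintro ⟨h1, h2⟩
        exact hc (M + d) (by omega) (by omega) h1 h2
  by_cases hMN : M ≤ N
  · have := this (N - M) (by omega)
    rw [show M + (N - M) = N by omega] at this
    omega
  · have : rcount P N r ≤ rcount P M r := Nat.count_monotone _ (by omega)
    omega

open Classical in
lemma perm_of_balanced (P : ℕ → Prop) (hinf : (Set.ofPred P).Infinite)
    (hb : ∀ N r r', rcount P N r ≤ rcount P N r' + 1) (q : ℕ) :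
    Function.Bijective (fun j : Fin 3 => ((Nat.nth P (q * 3 + j.val) : ℕ) : ZMod 3)) := by
  have key : ∀ q r, rcount P (Nat.nth P (q * 3)) r = q := by
    intro q r
    have h1 := rcount_sum P (Nat.nth P (q * 3))
    rw [Nat.count_nth_of_infinite hinf] at h1
    have h2 := hb (Nat.nth P (q * 3))
    have h01 := h2 0 1
    have h02 := h2 0 2
    have h10 := h2 1 0
    have h12 := h2 1 2
    have h20 := h2 2 0
    have h21 := h2 2 1
    have : r % 3 = 0 % 3 ∨ r % 3 = 1 % 3 ∨ r % 3 = 2 % 3 := by omega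
    rcases this with h | h | h <;> rw [rcount_congr P _ _ _ h] <;> omega
  have hsurj : Function.Surjective
      (fun j : Fin 3 => ((Nat.nth P (q * 3 + j.val) : ℕ) : ZMod 3)) := by
    intro y
    obtain ⟨x, hx1, hx2, hx3, hx4⟩ := exists_of_rcount_lt P (Nat.nth P (q * 3))
      (Nat.nth P ((q + 1) * 3)) y.val (by rw [key, key]; omega)
    have hx : Nat.nth P (Nat.count P x) = x := Nat.nth_count hx3
    rw [← hx, Nat.nth_le_nth hinf] at hx1
    rw [← hx, Nat.nth_lt_nth hinf] at hx2
    refine ⟨⟨Nat.count P x - q * 3, by omega⟩, ?_⟩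
    simp only
    rw [show q * 3 + (Nat.count P x - q * 3) = Nat.count P x by omega, hx]
    have h5 : ((x : ℕ) : ZMod 3) = ((y.val : ℕ) : ZMod 3) :=
      (ZMod.natCast_eq_natCast_iff' _ _ _).2 hx4
    rw [h5, ZMod.natCast_zmod_val]
  exact (Fintype.bijective_iff_surjective_and_card _).2 ⟨hsurj, by simp⟩

lemma mem_iff_abc (a b c x : ℕ) :
    x ∈ AddSubmonoid.closure ({a, b, c} : Set ℕ) ↔ ∃ p y z, x = p * a + y * b + z * c := by
  constructor
  · intro h
    induction h using AddSubmonoid.closure_induction with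
    | mem x hx =>
      rcases hx with rfl | rfl | rfl
      · exact ⟨1, 0, 0, by ring⟩
      · exact ⟨0, 1, 0, by ring⟩
      · exact ⟨0, 0, 1, by ring⟩
    | zero => exact ⟨0, 0, 0, by ring⟩
    | add x y _ _ hx hy =>
      obtain ⟨p, q, r, rfl⟩ := hx
      obtain ⟨p', q', r', rfl⟩ := hy
      exact ⟨p + p', q + q', r + r', by ring⟩
  · rintro ⟨p, y, z, rfl⟩
    have h : ∀ n g, g ∈ ({a, b, c} : Set ℕ) →
        n * g ∈ AddSubmonoid.closure ({a, b, c} : Set ℕ) := by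
      intro n g hg
      rw [← smul_eq_mul]
      exact AddSubmonoid.nsmul_mem _ (AddSubmonoid.subset_closure hg) n
    exact add_mem (add_mem (h _ _ (by simp)) (h _ _ (by simp))) (h _ _ (by simp))

lemma mem_iff_level (k : ℕ) (hk : 2 ≤ k) (x : ℕ) :
    x ∈ AddSubmonoid.closure ({6 * k + 1, 12 * k - 4, 12 * k} : Set ℕ) ↔
      ∃ m t, t ≤ 3 * (m / 2) ∧ t + 1 ≠ 3 * (m / 2) ∧ x + 2 * t = m * (6 * k + 1) := by
  rw [mem_iff_abc]
  obtain ⟨b, hb⟩ : ∃ b, 12 * k - 4 = b := ⟨_, rfl⟩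
  have hb' : b + 4 = 12 * k := by omega
  rw [hb]
  constructor
  · rintro ⟨p, y, z, rfl⟩
    refine ⟨p + 2 * y + 2 * z, 3 * y + z, by omega, by omega, ?_⟩
    zify at hb' ⊢
    rw [show (b : ℤ) = 12 * k - 4 by omega]
    ring
  · rintro ⟨m, t, h1, h2, h3⟩
    obtain ⟨y, z, h4, h5⟩ : ∃ y z, y + z ≤ m / 2 ∧ t = 3 * y + z := by
      by_cases h : t ≤ 3 * (m / 2) ∧ 3 * (m / 2) ≤ t + 3
      · by_cases h' : t = 3 * (m / 2)
        · exact ⟨m / 2, 0, by omega, by omega⟩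
        · exact ⟨m / 2 - 1, t - 3 * (m / 2 - 1), by omega, by omega⟩
      · exact ⟨t / 3, t % 3, by omega, by omega⟩
    refine ⟨m - 2 * y - 2 * z, y, z, ?_⟩
    obtain ⟨p, hp⟩ : ∃ p, m = p + 2 * y + 2 * z := ⟨m - 2 * y - 2 * z, by omega⟩
    subst hp
    rw [show p + 2 * y + 2 * z - 2 * y - 2 * z = p by omega]
    subst h5
    zify at hb' h3 ⊢
    rw [show (b : ℤ) = 12 * k - 4 by omega]
    linarith

/-- Local description of membership, up to `4k·a`. -/
lemma mem_local (k : ℕ) (hk : 2 ≤ k) (m i : ℕ) (hm : 1 ≤ m) (hm' : m ≤ 4 * k - 1)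
    (hi : 0 < i) (hi' : i ≤ 6 * k + 1) :
    m * (6 * k + 1) + i ∈ AddSubmonoid.closure ({6 * k + 1, 12 * k - 4, 12 * k} : Set ℕ) ↔
      (∃ t, t ≤ 3 * ((m + 1) / 2) ∧ t + 1 ≠ 3 * ((m + 1) / 2) ∧ i + 2 * t = 6 * k + 1) ∨
      (∃ s, s ≤ 3 * ((m + 2) / 2) ∧ s + 1 ≠ 3 * ((m + 2) / 2) ∧ i + 2 * s = 12 * k + 2) := by
  rw [mem_iff_level k hk]
  constructor
  · rintro ⟨m', t, h1, h2, h3⟩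
    have hlt : m < m' := by
      by_contra h
      have : m' * (6 * k + 1) ≤ m * (6 * k + 1) := Nat.mul_le_mul_right _ (by omega)
      omega
    obtain ⟨j, rfl⟩ : ∃ j, m' = m + j := ⟨m' - m, by omega⟩
    have h4 : i + 2 * t = j * (6 * k + 1) := by
      rw [add_mul] at h3; omega
    have hj : j < 4 := by
      by_contra h
      obtain ⟨l, rfl⟩ : ∃ l, j = l + 4 := ⟨j - 4, by omega⟩
      have h5 : (l + 4) * (6 * k + 1) = l * (6 * k + 1) + 24 * k + 4 := by ring
      have h6 : l * 13 ≤ l * (6 * k + 1) := Nat.mul_le_mul_left _ (by omega)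
      omega
    have : j = 1 ∨ j = 2 ∨ j = 3 := by omega
    rcases this with rfl | rfl | rfl
    · left; exact ⟨t, h1, h2, by omega⟩
    · right; exact ⟨t, h1, h2, by omega⟩
    · left
      exact ⟨(6 * k + 1 - i) / 2, by omega, by omega, by omega⟩
  · rintro (⟨t, h1, h2, h3⟩ | ⟨t, h1, h2, h3⟩)
    · exact ⟨m + 1, t, h1, h2, by rw [add_mul]; omega⟩
    · exact ⟨m + 2, t, h1, h2, by rw [add_mul]; omega⟩

/-- Past `4k·a` everything is in the semigroup. -/
lemma mem_late (k : ℕ) (hk : 2 ≤ k) (x : ℕ) (hx : 4 * k * (6 * k + 1) ≤ x) :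
    x ∈ AddSubmonoid.closure ({6 * k + 1, 12 * k - 4, 12 * k} : Set ℕ) := by
  rw [mem_iff_level k hk]
  have hdm := Nat.div_add_mod x (6 * k + 1)
  have hlt := Nat.mod_lt x (show 6 * k + 1 > 0 by omega)
  have hm : 4 * k ≤ x / (6 * k + 1) := (Nat.le_div_iff_mul_le (by omega)).2 hx
  generalize x / (6 * k + 1) = m at *
  generalize x % (6 * k + 1) = i at *
  rw [mul_comm] at hdm
  by_cases h : i % 2 = 1
  · exact ⟨m + 1, (6 * k + 1 - i) / 2, by omega, by omega, by rw [add_mul]; omega⟩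
  · exact ⟨m + 2, (12 * k + 2 - i) / 2, by omega, by omega, by rw [add_mul]; omega⟩

lemma mem_small (k : ℕ) (hk : 2 ≤ k) (x : ℕ) (hx0 : 0 < x) (hx : x ≤ 12 * k)
    (h : x ∈ AddSubmonoid.closure ({6 * k + 1, 12 * k - 4, 12 * k} : Set ℕ)) :
    x = 6 * k + 1 ∨ x = 12 * k - 4 ∨ x = 12 * k := by
  rw [mem_iff_level k hk] at h
  obtain ⟨m, t, h1, h2, h3⟩ := h
  have : m < 3 := by
    by_contra hm
    obtain ⟨l, rfl⟩ : ∃ l, m = l + 3 := ⟨m - 3, by omega⟩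
    have h5 : (l + 3) * (6 * k + 1) = l * (6 * k + 1) + 18 * k + 3 := by ring
    have h6 : l * 13 ≤ l * (6 * k + 1) := Nat.mul_le_mul_left _ (by omega)
    omega
  interval_cases m <;> omega

/-- The explicit deviation vector. -/
def devA (t h1 : ℕ) : ℤ := if t + 1 ≥ 3 * h1 ∨ t % 3 = 2 then 1 else 0
def devB (t h1 s h2 : ℕ) : ℤ :=
  (if t > 3 * h1 then 0 else if t + 1 ≥ 3 * h1 then 1 else if t % 3 = 1 then 0 else 1) +
  (if s + 1 ≥ 3 * h2 then 0 else if s % 3 = 2 then 0 else -1)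
def devC (s h2 : ℕ) : ℤ :=
  if s > 3 * h2 then 0 else if s + 1 ≥ 3 * h2 then 1 else if s % 3 = 1 then 0 else 1

lemma dev_even (k : ℕ) (hk : 2 ≤ k) (T j h1 h2 : ℕ) (hT : T + j = 3 * k)
    (h12 : h1 = h2 ∨ h1 + 1 = h2) (h1pos : 1 ≤ h1) (h2le : h2 ≤ 2 * k) :
    ((T ≤ 3 * h1 ∧ T + 1 ≠ 3 * h1) → ∃ δ : ℤ,
      devA (T + 1) h1 + (if (2 * j) % 3 = 2 then 1 else 0) = δ + devA T h1 ∧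
      devB (T + 1) h1 (T + 3 * k + 1) h2 + (if (2 * j) % 3 = 0 then 1 else 0) =
        δ + devB T h1 (T + 3 * k + 1) h2 ∧
      (if (2 * j) % 3 = 1 then 1 else 0) = δ) ∧
    (¬ (T ≤ 3 * h1 ∧ T + 1 ≠ 3 * h1) →
      devA (T + 1) h1 = devA T h1 ∧
      devB (T + 1) h1 (T + 3 * k + 1) h2 = devB T h1 (T + 3 * k + 1) h2) := by
  have hj : (2 * j) % 3 = T % 3 := by omega
  rw [hj]
  unfold devA devB
  generalize (if T + 3 * k + 1 + 1 ≥ 3 * h2 then (0 : ℤ) else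
    if (T + 3 * k + 1) % 3 = 2 then 0 else -1) = B
  constructor
  · intro h
    refine ⟨_, ?_, ?_, rfl⟩
    · split_ifs <;> omega
    · split_ifs <;> omega
  · intro h
    constructor <;> split_ifs <;> omega

lemma dev_odd (k : ℕ) (hk : 2 ≤ k) (T j h1 h2 : ℕ) (hT : T + j = 3 * k)
    (h12 : h1 = h2 ∨ h1 + 1 = h2) (h1pos : 1 ≤ h1) (h2le : h2 ≤ 2 * k) :
    ((T + 3 * k ≤ 3 * h2 ∧ T + 3 * k + 1 ≠ 3 * h2) → ∃ δ : ℤ,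
      (if (2 * j + 1) % 3 = 2 then 1 else 0) = δ ∧
      devB T h1 (T + 3 * k + 1) h2 + (if (2 * j + 1) % 3 = 0 then 1 else 0) =
        δ + devB T h1 (T + 3 * k) h2 ∧
      devC (T + 3 * k + 1) h2 + (if (2 * j + 1) % 3 = 1 then 1 else 0) =
        δ + devC (T + 3 * k) h2) ∧
    (¬ (T + 3 * k ≤ 3 * h2 ∧ T + 3 * k + 1 ≠ 3 * h2) →
      devB T h1 (T + 3 * k + 1) h2 = devB T h1 (T + 3 * k) h2 ∧
      devC (T + 3 * k + 1) h2 = devC (T + 3 * k) h2) := by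
  have hj : (2 * j + 1) % 3 = (T + 1) % 3 := by omega
  rw [hj]
  unfold devB devC
  generalize (if T > 3 * h1 then (0 : ℤ) else if T + 1 ≥ 3 * h1 then 1 else
    if T % 3 = 1 then 0 else 1) = B
  constructor
  · intro h
    refine ⟨_, rfl, ?_, ?_⟩
    · split_ifs <;> omega
    · split_ifs <;> omega
  · intro h
    constructor <;> split_ifs <;> omega

def InvG (P : ℕ → Prop) (k m i : ℕ) : Prop :=
  ∃ q : ℤ,
    (rcount P (m * (6 * k + 1) + i + 1) m : ℤ) =
      q + devA ((6 * k + 2 - i) / 2) ((m + 1) / 2) ∧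
    (rcount P (m * (6 * k + 1) + i + 1) (m + 1) : ℤ) =
      q + devB ((6 * k + 2 - i) / 2) ((m + 1) / 2) ((12 * k + 3 - i) / 2) ((m + 2) / 2) ∧
    (rcount P (m * (6 * k + 1) + i + 1) (m + 2) : ℤ) =
      q + devC ((12 * k + 3 - i) / 2) ((m + 2) / 2)

def PG (k : ℕ) : ℕ → Prop := fun x =>
  x ∈ AddSubmonoid.closure ({6 * k + 1, 12 * k - 4, 12 * k} : Set ℕ) ∧ 0 < x

lemma rcount_small (k : ℕ) (hk : 2 ≤ k) (r N : ℕ) (hN : N ≤ 6 * k + 1) :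
    rcount (PG k) N r = 0 := by
  induction N with
  | zero => simp [rcount]
  | succ N ih =>
    rw [rcount_succ, ih (by omega), if_neg]
    rintro ⟨⟨h1, h2⟩, -⟩
    have := mem_small k hk N h2 (by omega) h1
    omega

lemma inv_base (k : ℕ) (hk : 2 ≤ k) : InvG (PG k) k 1 0 := by
  have hP : PG k (6 * k + 1) := ⟨AddSubmonoid.subset_closure (by simp), by omega⟩
  refine ⟨0, ?_⟩
  rw [one_mul, add_zero]
  rw [rcount_succ_of _ _ _ hP True (by simp; omega), rcount_succ_of _ _ _ hP False (by simp; omega),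
    rcount_succ_of _ _ _ hP False (by simp; omega)]
  simp only [rcount_small k hk _ _ le_rfl]
  rw [show (6 * k + 2 - 0) / 2 = 3 * k + 1 by omega, show (12 * k + 3 - 0) / 2 = 6 * k + 1 by omega,
    show (1 + 1) / 2 = 1 by omega]
  unfold devA devB devC
  rw [if_pos (show 3 * k + 1 + 1 ≥ 3 * 1 ∨ (3 * k + 1) % 3 = 2 by omega),
    if_pos (show 3 * k + 1 > 3 * 1 by omega),
    if_pos (show 6 * k + 1 + 1 ≥ 3 * 1 by omega), if_pos (show 6 * k + 1 > 3 * 1 by omega)]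
  simp

set_option maxHeartbeats 2000000 in
lemma inv_step (k : ℕ) (hk : 2 ≤ k) (m i : ℕ) (hm : 1 ≤ m) (hm' : m ≤ 4 * k - 1)
    (hi : i < 6 * k + 1) (h : InvG (PG k) k m i) : InvG (PG k) k m (i + 1) := by
  have hloc := mem_local k hk m (i + 1) hm hm' (by omega) (by omega)
  have hP : PG k (m * (6 * k + 1) + (i + 1)) ↔
      ((i % 2 = 0 ∧ (6 * k - i) / 2 ≤ 3 * ((m + 1) / 2) ∧
          (6 * k - i) / 2 + 1 ≠ 3 * ((m + 1) / 2)) ∨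
       (i % 2 = 1 ∧ (12 * k + 1 - i) / 2 ≤ 3 * ((m + 2) / 2) ∧
          (12 * k + 1 - i) / 2 + 1 ≠ 3 * ((m + 2) / 2))) := by
    unfold PG
    rw [hloc]
    constructor
    · rintro ⟨⟨t, h1, h2, h3⟩ | ⟨t, h1, h2, h3⟩, -⟩
      · left; omega
      · right; omega
    · rintro (⟨h1, h2, h3⟩ | ⟨h1, h2, h3⟩)
      · exact ⟨Or.inl ⟨(6 * k - i) / 2, by omega, by omega, by omega⟩, by omega⟩
      · exact ⟨Or.inr ⟨(12 * k + 1 - i) / 2, by omega, by omega, by omega⟩, by omega⟩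
  have hmod : (m * (6 * k + 1) + (i + 1)) % 3 = (m + i + 1) % 3 := by
    rw [show m * (6 * k + 1) + (i + 1) = (m + i + 1) + 3 * (2 * (m * k)) by ring]
    omega
  obtain ⟨q, e1, e2, e3⟩ := h
  unfold InvG
  rw [← add_assoc] at hP hmod ⊢
  clear hloc
  generalize m * (6 * k + 1) + i + 1 = N at *
  have hx : (N % 3 = m % 3) ↔ i % 3 = 2 := by omega
  have hy : (N % 3 = (m + 1) % 3) ↔ i % 3 = 0 := by omega
  have hz : (N % 3 = (m + 2) % 3) ↔ i % 3 = 1 := by omega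
  generalize hh1 : (m + 1) / 2 = h1 at *
  generalize hh2 : (m + 2) / 2 = h2 at *
  have h12 : h1 = h2 ∨ h1 + 1 = h2 := by clear hP hx hy hz; omega
  have h1pos : 1 ≤ h1 := by clear hP hx hy hz; omega
  have h2le : h2 ≤ 2 * k := by clear hP hx hy hz; omega
  clear hh1 hh2 hmod hm hm'
  obtain ⟨j, hj | hj⟩ : ∃ j, i = 2 * j ∨ i = 2 * j + 1 := ⟨i / 2, by clear hP hx hy hz; omega⟩
  · subst hj
    obtain ⟨T, hT⟩ : ∃ T, T + j = 3 * k := ⟨3 * k - j, by clear hP hx hy hz; omega⟩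
    rw [show (6 * k + 2 - 2 * j) / 2 = T + 1 by clear hP hx hy hz; omega] at e1 e2
    rw [show (12 * k + 3 - 2 * j) / 2 = T + 3 * k + 1 by clear hP hx hy hz; omega] at e2 e3
    rw [show (6 * k + 2 - (2 * j + 1)) / 2 = T by clear hP hx hy hz; omega,
      show (12 * k + 3 - (2 * j + 1)) / 2 = T + 3 * k + 1 by clear hP hx hy hz; omega]
    have hTT : (6 * k - 2 * j) / 2 = T := by clear hP hx hy hz; omega
    rw [hTT] at hP
    have hp : PG k N ↔ T ≤ 3 * h1 ∧ T + 1 ≠ 3 * h1 := by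
      rw [hP]; clear hP hx hy hz; omega
    have := dev_even k hk T j h1 h2 hT h12 h1pos h2le
    by_cases hpp : PG k N
    · rw [rcount_succ_of _ _ _ hpp _ hx, rcount_succ_of _ _ _ hpp _ hy,
        rcount_succ_of _ _ _ hpp _ hz]
      obtain ⟨δ, d1, d2, d3⟩ := this.1 (hp.1 hpp)
      push_cast
      rw [e1, e2, e3]
      exact ⟨q + δ, by linarith, by linarith, by linarith⟩
    · rw [rcount_succ_not _ _ _ hpp, rcount_succ_not _ _ _ hpp, rcount_succ_not _ _ _ hpp]
      obtain ⟨d1, d2⟩ := this.2 (fun h => hpp (hp.2 h))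
      rw [e1, e2, e3]
      exact ⟨q, by linarith, by linarith, by linarith⟩
  · subst hj
    obtain ⟨T, hT⟩ : ∃ T, T + j = 3 * k := ⟨3 * k - j, by clear hP hx hy hz; omega⟩
    rw [show (6 * k + 2 - (2 * j + 1)) / 2 = T by clear hP hx hy hz; omega] at e1 e2
    rw [show (12 * k + 3 - (2 * j + 1)) / 2 = T + 3 * k + 1 by clear hP hx hy hz; omega] at e2 e3
    rw [show (6 * k + 2 - (2 * j + 1 + 1)) / 2 = T by clear hP hx hy hz; omega,
      show (12 * k + 3 - (2 * j + 1 + 1)) / 2 = T + 3 * k by clear hP hx hy hz; omega]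
    have hTT : (12 * k + 1 - (2 * j + 1)) / 2 = T + 3 * k := by clear hP hx hy hz; omega
    rw [hTT] at hP
    have hp : PG k N ↔ T + 3 * k ≤ 3 * h2 ∧ T + 3 * k + 1 ≠ 3 * h2 := by
      rw [hP]; clear hP hx hy hz; omega
    have := dev_odd k hk T j h1 h2 hT h12 h1pos h2le
    by_cases hpp : PG k N
    · rw [rcount_succ_of _ _ _ hpp _ hx, rcount_succ_of _ _ _ hpp _ hy,
        rcount_succ_of _ _ _ hpp _ hz]
      obtain ⟨δ, d1, d2, d3⟩ := this.1 (hp.1 hpp)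
      push_cast
      rw [e1, e2, e3]
      exact ⟨q + δ, by linarith, by linarith, by linarith⟩
    · rw [rcount_succ_not _ _ _ hpp, rcount_succ_not _ _ _ hpp, rcount_succ_not _ _ _ hpp]
      obtain ⟨d1, d2⟩ := this.2 (fun h => hpp (hp.2 h))
      rw [e1, e2, e3]
      exact ⟨q, by linarith, by linarith, by linarith⟩

lemma inv_next (k : ℕ) (hk : 2 ≤ k) (m : ℕ) (hm : 1 ≤ m) (hm' : m + 1 ≤ 4 * k - 1)
    (h : InvG (PG k) k m (6 * k + 1)) : InvG (PG k) k (m + 1) 0 := by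
  obtain ⟨q, e1, e2, e3⟩ := h
  unfold InvG
  rw [show (m + 1) * (6 * k + 1) + 0 + 1 = m * (6 * k + 1) + (6 * k + 1) + 1 by ring]
  rw [rcount_congr _ _ (m + 1 + 2) m (by omega), show m + 1 + 1 = m + 2 from rfl,
    show m + 1 + 2 = m + 3 from rfl]
  rw [e1, e2, e3]
  rw [show (6 * k + 2 - (6 * k + 1)) / 2 = 0 by omega,
    show (12 * k + 3 - (6 * k + 1)) / 2 = 3 * k + 1 by omega,
    show (6 * k + 2 - 0) / 2 = 3 * k + 1 by omega,
    show (12 * k + 3 - 0) / 2 = 6 * k + 1 by omega]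
  have a1 : 1 ≤ (m + 1) / 2 := by omega
  have a2 : (m + 3) / 2 ≤ 2 * k := by omega
  rw [show m + 1 + 1 = m + 2 from rfl]
  generalize (m + 1) / 2 = h1 at *
  generalize (m + 2) / 2 = h2 at *
  generalize (m + 3) / 2 = h3 at *
  refine ⟨q + (devB 0 h1 (3 * k + 1) h2 - devA (3 * k + 1) h2), by ring, ?_, ?_⟩
  · have b1 : devB 0 h1 (3 * k + 1) h2 = 1 + if 3 * k + 1 + 1 ≥ 3 * h2 then 0 else -1 := by
      unfold devB
      rw [if_neg (by omega), if_neg (by omega), if_neg (by omega)]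
      rw [if_neg (show ¬ (3 * k + 1) % 3 = 2 by omega)]
    have b2 : devB (3 * k + 1) h2 (6 * k + 1) h3 =
        if 3 * k + 1 > 3 * h2 then 0 else if 3 * k + 1 + 1 ≥ 3 * h2 then 1 else 0 := by
      unfold devB
      rw [if_pos (show 6 * k + 1 + 1 ≥ 3 * h3 by omega), if_pos (show (3 * k + 1) % 3 = 1 by omega)]
      ring
    rw [b1, b2]
    unfold devA devC
    split_ifs <;> omega
  · have b1 : devB 0 h1 (3 * k + 1) h2 = 1 + if 3 * k + 1 + 1 ≥ 3 * h2 then 0 else -1 := by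
      unfold devB
      rw [if_neg (by omega), if_neg (by omega), if_neg (by omega)]
      rw [if_neg (show ¬ (3 * k + 1) % 3 = 2 by omega)]
    have b2 : devA 0 h1 = 0 := by
      unfold devA
      rw [if_neg (by omega)]
    have b3 : devC (6 * k + 1) h3 = 0 := by
      unfold devC
      rw [if_pos (by omega)]
    rw [b1, b2, b3]
    unfold devA
    split_ifs <;> omega

lemma inv_all (k : ℕ) (hk : 2 ≤ k) (m : ℕ) (hm : 1 ≤ m) :
    m ≤ 4 * k - 1 → ∀ i, i ≤ 6 * k + 1 → InvG (PG k) k m i := by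
  have row : ∀ m, 1 ≤ m → m ≤ 4 * k - 1 → InvG (PG k) k m 0 →
      ∀ i, i ≤ 6 * k + 1 → InvG (PG k) k m i := by
    intro m hm hm' h0 i
    induction i with
    | zero => intro _; exact h0
    | succ i ih => intro hi; exact inv_step k hk m i hm hm' (by omega) (ih (by omega))
  induction m, hm using Nat.le_induction with
  | base => intro h; exact row 1 le_rfl h (inv_base k hk)
  | succ m hm ih =>
    intro h
    exact row (m + 1) (by omega) h (inv_next k hk m hm h (ih (by omega) _ le_rfl))

lemma balanced_of_inv (k : ℕ) (hk : 2 ≤ k) (m i : ℕ) (hm : 1 ≤ m) (hm' : m ≤ 4 * k - 1)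
    (hi : i ≤ 6 * k + 1) (h : InvG (PG k) k m i) (r r' : ℕ) :
    rcount (PG k) (m * (6 * k + 1) + i + 1) r ≤
      rcount (PG k) (m * (6 * k + 1) + i + 1) r' + 1 := by
  obtain ⟨q, e1, e2, e3⟩ := h
  have hr : ∀ r, r % 3 = m % 3 ∨ r % 3 = (m + 1) % 3 ∨ r % 3 = (m + 2) % 3 := by
    intro r; omega
  have key : ∀ A B C : ℤ,
      A = devA ((6 * k + 2 - i) / 2) ((m + 1) / 2) →
      B = devB ((6 * k + 2 - i) / 2) ((m + 1) / 2) ((12 * k + 3 - i) / 2) ((m + 2) / 2) →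
      C = devC ((12 * k + 3 - i) / 2) ((m + 2) / 2) →
      (A ≤ B + 1 ∧ B ≤ A + 1 ∧ A ≤ C + 1 ∧ C ≤ A + 1 ∧ B ≤ C + 1 ∧ C ≤ B + 1) := by
    intro A B C hA hB hC
    unfold devA at hA
    unfold devB at hB
    unfold devC at hC
    split_ifs at hA hB hC <;> omega
  have := key _ _ _ rfl rfl rfl
  rcases hr r with h | h | h <;> rcases hr r' with h' | h' | h' <;>
    rw [rcount_congr _ _ _ _ h, rcount_congr _ _ _ _ h'] <;> omega

lemma late (k : ℕ) (hk : 2 ≤ k) (d : ℕ) :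
    ∃ q : ℤ,
      (rcount (PG k) (4 * k * (6 * k + 1) + 1 + d) (4 * k) : ℤ) = q ∧
      (rcount (PG k) (4 * k * (6 * k + 1) + 1 + d) (4 * k + 1) : ℤ) =
        q + (if d % 3 = 0 then 0 else 1) ∧
      (rcount (PG k) (4 * k * (6 * k + 1) + 1 + d) (4 * k + 2) : ℤ) =
        q + (if d % 3 = 2 then 1 else 0) := by
  induction d with
  | zero =>
    obtain ⟨q, e1, e2, e3⟩ := inv_all k hk (4 * k - 1) (by omega) le_rfl (6 * k + 1) le_rfl
    have hN : (4 * k - 1) * (6 * k + 1) + (6 * k + 1) + 1 = 4 * k * (6 * k + 1) + 1 + 0 := by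
      obtain ⟨l, hl⟩ : ∃ l, 4 * k = l + 1 := ⟨4 * k - 1, by omega⟩
      rw [hl, show l + 1 - 1 = l by omega]; ring
    rw [hN] at e1 e2 e3
    rw [rcount_congr _ _ (4 * k - 1) (4 * k + 2) (by omega)] at e1
    rw [show 4 * k - 1 + 1 = 4 * k by omega] at e1 e2
    rw [show 4 * k - 1 + 2 = 4 * k + 1 by omega] at e2 e3
    rw [show (6 * k + 2 - (6 * k + 1)) / 2 = 0 by omega] at e1 e2
    rw [show (12 * k + 3 - (6 * k + 1)) / 2 = 3 * k + 1 by omega] at e2 e3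
    rw [show 4 * k / 2 = 2 * k by omega] at e1 e2
    rw [show (4 * k + 1) / 2 = 2 * k by omega] at e2 e3
    have hA : devA 0 (2 * k) = 0 := by
      unfold devA; rw [if_neg (by omega)]
    have hB : devB 0 (2 * k) (3 * k + 1) (2 * k) = 0 := by
      unfold devB
      rw [if_neg (by omega), if_neg (by omega), if_neg (by omega), if_neg (by omega),
        if_neg (by omega)]
      rfl
    have hC : devC (3 * k + 1) (2 * k) = 0 := by unfold devC; split_ifs <;> omega
    rw [hA] at e1
    rw [hB] at e2
    rw [hC] at e3
    exact ⟨q, by simpa using e2, by simpa using e3, by simpa using e1⟩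
  | succ d ih =>
    obtain ⟨q, e1, e2, e3⟩ := ih
    have hP : PG k (4 * k * (6 * k + 1) + 1 + d) := ⟨mem_late k hk _ (by omega), by omega⟩
    have hmod : (4 * k * (6 * k + 1) + 1 + d) % 3 = (4 * k + 1 + d) % 3 := by
      rw [show 4 * k * (6 * k + 1) + 1 + d = (4 * k + 1 + d) + 3 * (8 * (k * k)) by ring]
      omega
    rw [← add_assoc]
    generalize 4 * k * (6 * k + 1) + 1 + d = N at *
    generalize 4 * k = M at *
    rw [rcount_succ_of _ _ M hP (d % 3 = 2) (by omega),
      rcount_succ_of _ _ (M + 1) hP (d % 3 = 0) (by omega),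
      rcount_succ_of _ _ (M + 2) hP (d % 3 = 1) (by omega)]
    refine ⟨q + (if d % 3 = 2 then 1 else 0), ?_, ?_, ?_⟩
    · push_cast
      rw [e1]
    · push_cast
      rw [e2]
      split_ifs <;> omega
    · push_cast
      rw [e3]
      split_ifs <;> omega

lemma balanced (k : ℕ) (hk : 2 ≤ k) (N r r' : ℕ) :
    rcount (PG k) N r ≤ rcount (PG k) N r' + 1 := by
  by_cases h1 : N ≤ 6 * k + 1
  · rw [rcount_small k hk r N h1]; omega
  by_cases h2 : N < 4 * k * (6 * k + 1) + 1
  · obtain ⟨M, rfl⟩ : ∃ M, N = M + 1 := ⟨N - 1, by omega⟩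
    have hdm := Nat.div_add_mod M (6 * k + 1)
    have hlt := Nat.mod_lt M (show 6 * k + 1 > 0 by omega)
    have hm : 1 ≤ M / (6 * k + 1) := (Nat.le_div_iff_mul_le (by omega)).2 (by omega)
    have hm' : M / (6 * k + 1) < 4 * k := (Nat.div_lt_iff_lt_mul (by omega)).2 (by omega)
    generalize M / (6 * k + 1) = m at *
    generalize M % (6 * k + 1) = i at *
    rw [mul_comm] at hdm
    rw [← hdm]
    exact balanced_of_inv k hk m i hm (by omega) (by omega)
      (inv_all k hk m hm (by omega) i (by omega)) r r'
  · obtain ⟨d, rfl⟩ : ∃ d, N = 4 * k * (6 * k + 1) + 1 + d :=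
      ⟨N - (4 * k * (6 * k + 1) + 1), by omega⟩
    obtain ⟨q, e1, e2, e3⟩ := late k hk d
    have hr : ∀ r, r % 3 = (4 * k) % 3 ∨ r % 3 = (4 * k + 1) % 3 ∨ r % 3 = (4 * k + 2) % 3 := by
      intro r; generalize 4 * k = M; omega
    rcases hr r with h | h | h <;> rcases hr r' with h' | h' | h' <;>
      rw [rcount_congr _ _ _ _ h, rcount_congr _ _ _ _ h'] <;> clear h h' hr <;>
      split_ifs at e2 e3 <;> omega

open Classical in
lemma gen_mem_image (k : ℕ) (hk : 2 ≤ k) (x : ℕ) (hx : PG k x) (hle : x ≤ 12 * k) :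
    x ∈ Nat.nth (PG k) '' Set.Iio 3 := by
  refine ⟨Nat.count (PG k) x, ?_, Nat.nth_count hx⟩
  have h : Nat.count (PG k) x ≤ 2 := by
    rw [Nat.count_eq_card_filter_range]
    have hsub : (Finset.range x).filter (PG k) ⊆ {6 * k + 1, 12 * k - 4} := by
      intro y hy
      rw [Finset.mem_filter, Finset.mem_range] at hy
      have := mem_small k hk y hy.2.2 (by omega) hy.2.1
      simp only [Finset.mem_insert, Finset.mem_singleton]
      omega
    exact (Finset.card_le_card hsub).trans Finset.card_le_two
  simp only [Set.mem_Iio]; omega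

theorem family5_is_three_permutation (k : ℕ) (hk : 2 ≤ k) :
    IsPermutationSemigroup 3 (AddSubmonoid.closure ({6 * k + 1, 12 * k - 4, 12 * k} : Set ℕ)) := by
  have hinf : (Set.ofPred (PG k)).Infinite := by
    refine Set.infinite_of_not_bddAbove ?_
    rintro ⟨B, hB⟩
    have : 4 * k * (6 * k + 1) + B + 1 ≤ B :=
      hB (show PG k _ from ⟨mem_late k hk _ (by omega), by omega⟩)
    omega
  refine ⟨?_, ?_, ?_⟩
  · refine (Set.finite_Iio (4 * k * (6 * k + 1))).subset ?_
    intro x hx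
    by_contra h
    exact hx (mem_late k hk x (by simpa using h))
  · change _ = AddSubmonoid.closure (Nat.nth (PG k) '' Set.Iio 3)
    apply le_antisymm
    · rw [AddSubmonoid.closure_le]
      intro x hx
      apply AddSubmonoid.subset_closure
      have hmem := AddSubmonoid.subset_closure (M := ℕ) hx
      simp only [Set.mem_insert_iff, Set.mem_singleton_iff] at hx
      exact gen_mem_image k hk x ⟨hmem, by omega⟩ (by omega)
    · rw [AddSubmonoid.closure_le]
      rintro x ⟨n, -, rfl⟩
      exact (Nat.nth_mem_of_infinite hinf n).1
  · intro q
    exact perm_of_balanced (PG k) hinf (balanced k hk) q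
end

section
/- For every integer k ≥ 2 and every natural number x, x belongs to the numerical semigroup generated by S = {6k+1, 12k−4, 12k} if and only if x = (p + 2q)·(6k+1) + 4r − 6q for some natural numbers p, q, r with 0 ≤ r ≤ q. -/
theorem mem_closure_iff_repr (k : ℕ) (hk : 2 ≤ k) (x : ℕ) :
    x ∈ AddSubmonoid.closure ({6 * k + 1, 12 * k - 4, 12 * k} : Set ℕ) ↔
      ∃ p q r : ℕ, r ≤ q ∧
        (x : ℤ) = ((p : ℤ) + 2 * q) * (6 * k + 1) + 4 * r - 6 * q := by
  have hc : ((12 * k - 4 : ℕ) : ℤ) = 12 * k - 4 := by omega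
  constructor
  · intro hx
    induction hx using AddSubmonoid.closure_induction with
    | mem y hy =>
      simp only [Set.mem_insert_iff, Set.mem_singleton_iff] at hy
      rcases hy with rfl | rfl | rfl
      · exact ⟨1, 0, 0, le_refl _, by push_cast; ring⟩
      · exact ⟨0, 1, 0, by omega, by rw [hc]; push_cast; ring⟩
      · exact ⟨0, 1, 1, le_refl _, by push_cast; ring⟩
    | zero => exact ⟨0, 0, 0, le_refl _, by simp⟩
    | add a b _ _ ha hb =>
      obtain ⟨p, q, r, h, e⟩ := ha
      obtain ⟨p', q', r', h', e'⟩ := hb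
      exact ⟨p + p', q + q', r + r', by omega, by push_cast; rw [e, e']; ring⟩
  · rintro ⟨p, q, r, h, e⟩
    obtain ⟨b, rfl⟩ := Nat.exists_eq_add_of_le h
    have hx : x = p • (6 * k + 1) + b • (12 * k - 4) + r • (12 * k) := by
      simp only [smul_eq_mul]
      zify
      rw [hc, e]
      push_cast
      ring
    rw [hx]
    refine add_mem (add_mem ?_ ?_) ?_ <;>
      exact nsmul_mem (AddSubmonoid.subset_closure (by simp)) _
end

section
/- For every positive integer k, the numerical semigroup generated by S = {3k+2, 3k+3, 3k+4} is a 3-permutation numerical semigroup. -/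
/-- Interval description of membership. -/
def Fam7Mem (b y : ℕ) : Prop := ∃ q, q * b ≤ y ∧ y ≤ q * b + 2 * q

/-- `y` is the successor of `x` for the predicate `P`. -/
def Fam7Succ (P : ℕ → Prop) (x y : ℕ) : Prop :=
  P y ∧ x < y ∧ ∀ z, x < z → z < y → ¬ P z

/-- Invariant of the block starting elements. -/
def Fam7Inv (b x : ℕ) : Prop :=
  (∀ y, x ≤ y → Fam7Mem b y) ∨
  ∃ m i, 1 ≤ m ∧ i ≤ 2 * m ∧ x = m * b + i ∧
    ((m % 3 = 0 ∧ i % 3 = 1) ∨ (m % 3 ≠ 0 ∧ i % 3 = 0))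

lemma fam7_mem_iff (b y : ℕ) :
    y ∈ AddSubmonoid.closure ({b, b + 1, b + 2} : Set ℕ) ↔ Fam7Mem b y := by
  constructor
  · intro h
    induction h using AddSubmonoid.closure_induction with
    | mem x hx =>
      simp only [Set.mem_insert_iff, Set.mem_singleton_iff] at hx
      exact ⟨1, by omega, by omega⟩
    | zero => exact ⟨0, by simp, by simp⟩
    | add x y _ _ hx hy =>
      obtain ⟨p, hp1, hp2⟩ := hx
      obtain ⟨q, hq1, hq2⟩ := hy
      exact ⟨p + q, by rw [add_mul]; omega, by rw [add_mul]; omega⟩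
  · rintro ⟨q, h1, h2⟩
    induction q generalizing y with
    | zero =>
      have : y = 0 := by omega
      subst this
      exact zero_mem _
    | succ q ih =>
      rw [add_mul, one_mul] at h1 h2
      have gen : ∀ d, d ≤ 2 → b + d ∈ AddSubmonoid.closure ({b, b + 1, b + 2} : Set ℕ) := by
        intro d hd
        apply AddSubmonoid.subset_closure
        simp only [Set.mem_insert_iff, Set.mem_singleton_iff]
        omega
      have key : ∀ d, d ≤ 2 → b + d ≤ y → q * b ≤ y - (b + d) →
          y - (b + d) ≤ q * b + 2 * q →
          y ∈ AddSubmonoid.closure ({b, b + 1, b + 2} : Set ℕ) := by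
        intro d hd h0 h3 h4
        have := add_mem (ih _ h3 h4) (gen d hd)
        rwa [Nat.sub_add_cancel h0] at this
      by_cases c0 : y ≤ q * b + b + 2 * q
      · exact key 0 (by omega) (by omega) (by omega) (by omega)
      · by_cases c1 : y ≤ q * b + b + 2 * q + 1
        · exact key 1 (by omega) (by omega) (by omega) (by omega)
        · exact key 2 (by omega) (by omega) (by omega) (by omega)

lemma fam7_tail (b m y : ℕ) (hb : 0 < b) (hm : b ≤ 2 * m + 1) (hy : m * b ≤ y) :
    Fam7Mem b y := by
  have h1 : m ≤ y / b := (Nat.le_div_iff_mul_le hb).2 hy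
  have h2 := Nat.div_add_mod y b
  have h3 := Nat.mod_lt y hb
  refine ⟨y / b, ?_, ?_⟩
  · rw [mul_comm]; omega
  · rw [mul_comm (y / b) b]; omega

lemma fam7_gap (b m y : ℕ) (h1 : m * b + 2 * m < y) (h2 : y < (m + 1) * b) :
    ¬ Fam7Mem b y := by
  rintro ⟨q, h3, h4⟩
  rcases Nat.lt_or_ge m q with h | h
  · have := Nat.mul_le_mul_right b (show m + 1 ≤ q from h)
    omega
  · have := Nat.mul_le_mul_right b h
    omega

lemma fam7_succ_one (b x : ℕ) (h : Fam7Mem b (x + 1)) :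
    Fam7Succ (fun y => Fam7Mem b y ∧ 0 < y) x (x + 1) :=
  ⟨⟨h, by omega⟩, by omega, fun z h1 h2 => by omega⟩

lemma fam7_succ_in (b m i : ℕ) (hi : i + 1 ≤ 2 * m) :
    Fam7Succ (fun y => Fam7Mem b y ∧ 0 < y) (m * b + i) (m * b + i + 1) :=
  fam7_succ_one _ _ ⟨m, by omega, by omega⟩

lemma fam7_succ_jump (b m : ℕ) (h : 2 * m + 1 < b) :
    Fam7Succ (fun y => Fam7Mem b y ∧ 0 < y) (m * b + 2 * m) ((m + 1) * b) := by
  have e : (m + 1) * b = m * b + b := by ring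
  refine ⟨⟨⟨m + 1, by omega, by omega⟩, by omega⟩, by omega, ?_⟩
  intro z h1 h2 h3
  exact fam7_gap b m z h1 h2 h3.1

lemma fam7_step (b x : ℕ) (hb : b % 3 = 2) (hx : Fam7Inv b x) :
    ∃ y z w, Fam7Succ (fun y => Fam7Mem b y ∧ 0 < y) x y ∧
      Fam7Succ (fun y => Fam7Mem b y ∧ 0 < y) y z ∧
      Fam7Succ (fun y => Fam7Mem b y ∧ 0 < y) z w ∧
      y % 3 = (x + 1) % 3 ∧ z % 3 = (x + 2) % 3 ∧ Fam7Inv b w := by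
  have tail : (∀ y, x ≤ y → Fam7Mem b y) → _ := fun h =>
    (⟨x + 1, x + 1 + 1, x + 1 + 1 + 1, fam7_succ_one _ _ (h _ (by omega)),
      fam7_succ_one _ _ (h _ (by omega)), fam7_succ_one _ _ (h _ (by omega)), rfl, rfl,
      Or.inl fun y hy => h y (by omega)⟩ :
    ∃ y z w, Fam7Succ (fun y => Fam7Mem b y ∧ 0 < y) x y ∧
      Fam7Succ (fun y => Fam7Mem b y ∧ 0 < y) y z ∧
      Fam7Succ (fun y => Fam7Mem b y ∧ 0 < y) z w ∧
      y % 3 = (x + 1) % 3 ∧ z % 3 = (x + 2) % 3 ∧ Fam7Inv b w)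
  rcases hx with h | ⟨m, i, hm, hi, rfl, hr⟩
  · exact tail h
  by_cases hT : b ≤ 2 * m + 1
  · exact tail fun y hy => fam7_tail b m y (by omega) hT (by omega)
  have hj := fam7_succ_jump b m (by omega)
  by_cases c3 : i + 3 ≤ 2 * m
  · exact ⟨_, _, _, fam7_succ_in b m i (by omega), fam7_succ_in b m (i + 1) (by omega),
      fam7_succ_in b m (i + 2) (by omega), rfl, rfl,
      Or.inr ⟨m, i + 3, hm, by omega, by omega, by omega⟩⟩
  by_cases c2 : i + 2 = 2 * m
  · rw [← c2] at hj
    exact ⟨_, _, _, fam7_succ_in b m i (by omega), fam7_succ_in b m (i + 1) (by omega),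
      hj, rfl, rfl, Or.inr ⟨m + 1, 0, by omega, by omega, by omega, by omega⟩⟩
  · have c1 : i + 1 = 2 * m := by omega
    have hm3 : m % 3 = 2 := by omega
    rw [← c1] at hj
    have hmb : (m * b) % 3 = 1 := by rw [Nat.mul_mod, hm3, hb]
    have e : (m + 1) * b = m * b + b := by ring
    refine ⟨_, _, _, fam7_succ_in b m i (by omega), hj,
      fam7_succ_in b (m + 1) 0 (by omega), rfl, ?_,
      Or.inr ⟨m + 1, 1, by omega, by omega, by omega, by omega⟩⟩
    omega

lemma fam7_nth_succ (P : ℕ → Prop) (hP : (setOf P).Infinite) (n x y : ℕ)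
    (hn : Nat.nth P n = x) (h : Fam7Succ P x y) : Nat.nth P (n + 1) = y := by
  classical
  obtain ⟨hy, hxy, hno⟩ := h
  have h1 : Nat.nth P n < Nat.nth P (n + 1) := Nat.nth_strictMono hP (Nat.lt_succ_self n)
  have h2 : P (Nat.nth P (n + 1)) := Nat.nth_mem_of_infinite hP _
  have h3 : Nat.nth P (Nat.count P y) = y := Nat.nth_count hy
  have h4 : n < Nat.count P y := by
    rw [← (Nat.nth_strictMono hP).lt_iff_lt, h3, hn]; exact hxy
  have h5 : Nat.nth P (n + 1) ≤ Nat.nth P (Nat.count P y) :=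
    (Nat.nth_strictMono hP).monotone h4
  by_contra hne
  exact hno _ (by omega) (by omega) h2

lemma fam7_nth_zero (P : ℕ → Prop) (hP : (setOf P).Infinite) (x : ℕ)
    (hx : P x) (h : ∀ z, P z → x ≤ z) : Nat.nth P 0 = x := by
  classical
  have h3 : Nat.nth P (Nat.count P x) = x := Nat.nth_count hx
  have h5 : Nat.nth P 0 ≤ Nat.nth P (Nat.count P x) :=
    (Nat.nth_strictMono hP).monotone (Nat.zero_le _)
  have := h _ (Nat.nth_mem_of_infinite hP 0)
  omega

lemma fam7_bij (f : Fin 3 → ℕ) (h1 : f 1 % 3 = (f 0 + 1) % 3) (h2 : f 2 % 3 = (f 0 + 2) % 3) :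
    Function.Bijective (fun j : Fin 3 => ((f j : ℕ) : ZMod 3)) := by
  rw [Fintype.bijective_iff_injective_and_card]
  refine ⟨?_, by simp [ZMod.card]⟩
  intro i j hij
  have hij' := (ZMod.natCast_eq_natCast_iff' _ _ _).1 hij
  fin_cases i <;> fin_cases j <;> simp at hij' ⊢ <;> omega

lemma fam7_main (b : ℕ) (hb : b % 3 = 2) :
    IsPermutationSemigroup 3 (AddSubmonoid.closure ({b, b + 1, b + 2} : Set ℕ)) := by
  have hseq : posSeq (AddSubmonoid.closure ({b, b + 1, b + 2} : Set ℕ)) =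
      Nat.nth (fun y => Fam7Mem b y ∧ 0 < y) := by
    unfold posSeq
    simp only [fam7_mem_iff]
  have hinf : (setOf (fun y => Fam7Mem b y ∧ 0 < y)).Infinite := by
    apply Set.infinite_of_not_bddAbove
    rintro ⟨B, hB⟩
    have h1 : B + 1 ≤ (B + 1) * b := Nat.le_mul_of_pos_right _ (by omega)
    have := hB (show (B + 1) * b ∈ setOf (fun y => Fam7Mem b y ∧ 0 < y) from
      ⟨⟨B + 1, le_rfl, by omega⟩, by omega⟩)
    omega
  have h0 : Nat.nth (fun y => Fam7Mem b y ∧ 0 < y) 0 = b := by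
    apply fam7_nth_zero _ hinf
    · exact ⟨⟨1, by omega, by omega⟩, by omega⟩
    · rintro z ⟨⟨q, h1, h2⟩, h3⟩
      have : 1 ≤ q := by
        rcases Nat.eq_zero_or_pos q with rfl | h
        · omega
        · exact h
      have := Nat.mul_le_mul_right b this
      omega
  have s1 := fam7_succ_one b b ⟨1, by omega, by omega⟩
  have s2 := fam7_succ_one b (b + 1) ⟨1, by omega, by omega⟩
  have n1 := fam7_nth_succ _ hinf 0 _ _ h0 s1
  have n2 := fam7_nth_succ _ hinf 1 _ _ n1 s2
  have hI : ∀ j, Fam7Inv b (Nat.nth (fun y => Fam7Mem b y ∧ 0 < y) (j * 3)) := by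
    intro j
    induction j with
    | zero =>
      rw [zero_mul, h0]
      exact Or.inr ⟨1, 0, by omega, by omega, by omega, by omega⟩
    | succ j ih =>
      obtain ⟨y, z, w, hy, hz, hw, -, -, h⟩ := fam7_step b _ hb ih
      have a1 := fam7_nth_succ _ hinf _ _ _ rfl hy
      have a2 := fam7_nth_succ _ hinf _ _ _ a1 hz
      have a3 := fam7_nth_succ _ hinf _ _ _ a2 hw
      rw [show (j + 1) * 3 = j * 3 + 1 + 1 + 1 by ring, a3]
      exact h
  refine ⟨?_, ?_, ?_⟩
  · apply (Set.finite_Iio (b * b)).subset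
    intro y hy
    by_contra hlt
    apply hy
    exact (fam7_mem_iff b y).2 (fam7_tail b b y (by omega) (by omega) (by simpa using hlt))
  · rw [hseq]
    congr 1
    ext y
    simp only [Set.mem_insert_iff, Set.mem_singleton_iff, Set.mem_image, Set.mem_Iio]
    constructor
    · rintro (rfl | rfl | rfl)
      · exact ⟨0, by omega, h0⟩
      · exact ⟨1, by omega, n1⟩
      · exact ⟨2, by omega, n2⟩
    · rintro ⟨i, hi, rfl⟩
      interval_cases i
      · exact Or.inl h0
      · exact Or.inr (Or.inl n1)
      · exact Or.inr (Or.inr n2)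
  · intro j
    rw [hseq]
    obtain ⟨y, z, w, hy, hz, hw, e1, e2, h⟩ := fam7_step b _ hb (hI j)
    have a1 := fam7_nth_succ _ hinf _ _ _ rfl hy
    have a2 := fam7_nth_succ _ hinf _ _ _ a1 hz
    rw [← a1] at e1
    rw [← a2] at e2
    exact fam7_bij (fun i => Nat.nth (fun y => Fam7Mem b y ∧ 0 < y) (j * 3 + i.val)) e1 e2

theorem family7_is_three_permutation (k : ℕ) (hk : 0 < k) :
    IsPermutationSemigroup 3 (AddSubmonoid.closure ({3 * k + 2, 3 * k + 3, 3 * k + 4} : Set ℕ)) := by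
  exact fam7_main (3 * k + 2) (by omega)
end

section
/- For every positive integer k, the numerical semigroup generated by S = {3k+2, 6k+1, 6k+3} is a 3-permutation numerical semigroup. -/
lemma f9_closed_form (k n : ℕ) :
    n ∈ AddSubmonoid.closure ({3 * k + 2, 6 * k + 1, 6 * k + 3} : Set ℕ) ↔
      ∃ w d, n + d = w * (3 * k + 2) ∧ d ≤ 3 * (w / 2) ∧ d + 1 ≠ 3 * (w / 2) := by
  constructor
  · intro h
    have h2 : ∃ w x y, n + (3 * x + y) = w * (3 * k + 2) ∧ 2 * (x + y) ≤ w := by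
      induction h using AddSubmonoid.closure_induction with
      | mem x hx =>
        simp only [Set.mem_insert_iff, Set.mem_singleton_iff] at hx
        rcases hx with rfl | rfl | rfl
        · exact ⟨1, 0, 0, by ring, by norm_num⟩
        · exact ⟨2, 1, 0, by ring, by norm_num⟩
        · exact ⟨2, 0, 1, by ring, by norm_num⟩
      | zero => exact ⟨0, 0, 0, by simp, by simp⟩
      | add u v _ _ hu hv =>
        obtain ⟨w, x, y, h1, h2⟩ := hu
        obtain ⟨w', x', y', h1', h2'⟩ := hv
        refine ⟨w + w', x + x', y + y', ?_, by omega⟩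
        rw [add_mul, ← h1, ← h1']
        ring
    obtain ⟨w, x, y, h1, h3⟩ := h2
    exact ⟨w, 3 * x + y, h1, by omega, by omega⟩
  · rintro ⟨w, d, h1, h2, h3⟩
    obtain ⟨x, y, rfl, hxy⟩ : ∃ x y, d = 3 * x + y ∧ 2 * (x + y) ≤ w :=
      ⟨d / 3, d % 3, by omega, by omega⟩
    obtain ⟨t, rfl⟩ := Nat.exists_eq_add_of_le hxy
    have hn : n = t • (3 * k + 2) + x • (6 * k + 1) + y • (6 * k + 3) := by
      simp only [smul_eq_mul]
      have : n + (3 * x + y) = t * (3 * k + 2) + x * (6 * k + 1) + y * (6 * k + 3) + (3 * x + y) := by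
        rw [h1]; ring
      omega
    rw [hn]
    refine add_mem (add_mem ?_ ?_) ?_ <;>
      refine nsmul_mem (AddSubmonoid.subset_closure ?_) _ <;> simp

lemma f9_nth_succ (P : ℕ → Prop) (hinf : (Set.ofPred P).Infinite) (n p q : ℕ)
    (hp : Nat.nth P n = p) (hq : P q) (hpq : p < q) (hno : ∀ x, P x → p < x → q ≤ x) :
    Nat.nth P (n + 1) = q := by
  apply le_antisymm
  · have : q ∈ Set.range (Nat.nth P) := by
      rw [Nat.range_nth_of_infinite hinf]; exact hq
    obtain ⟨j, rfl⟩ := this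
    rw [← hp, Nat.nth_lt_nth hinf] at hpq
    exact (Nat.nth_le_nth hinf).2 hpq
  · apply hno _ (Nat.nth_mem_of_infinite hinf _)
    rw [← hp, Nat.nth_lt_nth hinf]
    omega

lemma f9_nth_zero (P : ℕ → Prop) (hinf : (Set.ofPred P).Infinite) (q : ℕ)
    (hq : P q) (hno : ∀ x, P x → q ≤ x) : Nat.nth P 0 = q := by
  apply le_antisymm
  · have : q ∈ Set.range (Nat.nth P) := by
      rw [Nat.range_nth_of_infinite hinf]; exact hq
    obtain ⟨j, rfl⟩ := this
    exact (Nat.nth_le_nth hinf).2 (Nat.zero_le _)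
  · exact hno _ (Nat.nth_mem_of_infinite hinf _)

/-- Everything at least `(2k+1)a` is in the semigroup. -/
lemma f9_large (k n : ℕ) (hk : 0 < k) (hn : (2 * k + 1) * (3 * k + 2) ≤ n) :
    ∃ w d, n + d = w * (3 * k + 2) ∧ d ≤ 3 * (w / 2) ∧ d + 1 ≠ 3 * (w / 2) := by
  have hdm := Nat.div_add_mod n (3 * k + 2)
  have hlt := Nat.mod_lt n (show 3 * k + 2 > 0 by omega)
  have hge : 2 * k + 1 ≤ n / (3 * k + 2) := (Nat.le_div_iff_mul_le (by omega)).2 hn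
  generalize n / (3 * k + 2) = w at *
  generalize n % (3 * k + 2) = r at *
  rcases Nat.eq_zero_or_pos r with h | h
  · exact ⟨w, 0, by subst h; rw [mul_comm]; omega, by omega, by omega⟩
  · refine ⟨w + 1, 3 * k + 2 - r, ?_, by omega, by omega⟩
    rw [add_mul, mul_comm w]; omega

/-- Between level `w` and level `w+1`. -/
lemma f9_gap (k w x : ℕ) (hk : 0 < k) 
    (hx : ∃ w d, x + d = w * (3 * k + 2) ∧ d ≤ 3 * (w / 2) ∧ d + 1 ≠ 3 * (w / 2))
    (hlt : w * (3 * k + 2) < x) :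
    (w + 1) * (3 * k + 2) ≤ x + 3 * ((w + 1) / 2) ∧
      x + 3 * ((w + 1) / 2) ≠ (w + 1) * (3 * k + 2) + 1 := by
  obtain ⟨v, d, h1, h2, h3⟩ := hx
  have hv : w < v := by
    by_contra hc
    have : v * (3 * k + 2) ≤ w * (3 * k + 2) := Nat.mul_le_mul_right _ (by omega)
    omega
  obtain ⟨t, rfl⟩ := Nat.exists_eq_add_of_le (Nat.succ_le_of_lt hv)
  rw [Nat.succ_eq_add_one, add_mul (w + 1)] at h1
  have ht : t * 5 ≤ t * (3 * k + 2) := Nat.mul_le_mul_left _ (by omega)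
  have hT : t = 0 → t * (3 * k + 2) = 0 := by rintro rfl; simp
  generalize t * (3 * k + 2) = T at *
  generalize (w + 1) * (3 * k + 2) = W at *
  rcases Nat.eq_zero_or_pos t with rfl | ht0
  · simp only [Nat.succ_eq_add_one, add_zero] at h2 h3
    have := hT rfl
    omega
  · have hc : (w.succ + t) / 2 ≤ (w + 1) / 2 + t := by omega
    generalize (w.succ + t) / 2 = c at *
    generalize (w + 1) / 2 = c' at *
    omega

theorem family9_is_three_permutation (k : ℕ) (hk : 0 < k) :
    IsPermutationSemigroup 3 (AddSubmonoid.closure ({3 * k + 2, 6 * k + 1, 6 * k + 3} : Set ℕ)) := by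
  set G := AddSubmonoid.closure ({3 * k + 2, 6 * k + 1, 6 * k + 3} : Set ℕ) with hG
  have hmem : ∀ n, n ∈ G ↔ _ := f9_closed_form k
  have hlarge : ∀ n, (2 * k + 1) * (3 * k + 2) ≤ n → n ∈ G := fun n hn =>
    (hmem n).2 (f9_large k n hk hn)
  have hinf : (Set.ofPred (fun x => x ∈ G ∧ 0 < x)).Infinite := by
    rw [Set.infinite_iff_exists_gt]
    intro a
    exact ⟨(2 * k + 1) * (3 * k + 2) + a + 1, ⟨hlarge _ (by omega), by omega⟩, by omega⟩
  have h0 : posSeq G 0 = 1 * (3 * k + 2) := by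
    apply f9_nth_zero _ hinf
    · exact ⟨(hmem _).2 ⟨1, 0, by omega, by omega, by omega⟩, by omega⟩
    · rintro x ⟨hx, hx0⟩
      have := f9_gap k 0 x hk ((hmem x).1 hx) (by omega)
      omega
  have hsucc : ∀ n p q, posSeq G n = p → q ∈ G → p < q → (∀ x, x ∈ G → p < x → q ≤ x) →
      posSeq G (n + 1) = q := fun n p q hp hq hpq hno =>
    f9_nth_succ _ hinf n p q hp ⟨hq, by omega⟩ hpq (fun x hx => hno x hx.1)
  -- the step from the end of a level
  have stepA : ∀ n w, 1 ≤ w → w ≤ 2 * k → posSeq G n = w * (3 * k + 2) →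
      posSeq G (n + 1) = (w + 1) * (3 * k + 2) - 3 * ((w + 1) / 2) ∧
      posSeq G (n + 2) = (w + 1) * (3 * k + 2) - 3 * ((w + 1) / 2) + 2 ∧
      posSeq G (n + 3) = (w + 1) * (3 * k + 2) - 3 * ((w + 1) / 2) + 3 := by
    intro n w hw1 hw2 hn
    have hgap := fun x hx => f9_gap k w x hk ((hmem x).1 hx)
    have e : (w + 1) * (3 * k + 2) = w * (3 * k + 2) + (3 * k + 2) := by ring
    have hin : ∀ j, j ≤ 3 * ((w + 1) / 2) → j ≠ 1 →
        (w + 1) * (3 * k + 2) - 3 * ((w + 1) / 2) + j ∈ G := fun j hj hj1 =>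
      (hmem _).2 ⟨w + 1, 3 * ((w + 1) / 2) - j, by omega, by omega, by omega⟩
    have a1 : posSeq G (n + 1) = (w + 1) * (3 * k + 2) - 3 * ((w + 1) / 2) := by
      refine hsucc n _ _ hn (hin 0 (by omega) (by omega)) (by omega) ?_
      intro x hx hlt
      have := hgap x hx hlt
      omega
    have a2 : posSeq G (n + 2) = (w + 1) * (3 * k + 2) - 3 * ((w + 1) / 2) + 2 := by
      refine hsucc (n + 1) _ _ a1 (hin 2 (by omega) (by omega)) (by omega) ?_
      intro x hx hlt
      have := hgap x hx (by omega)
      omega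
    refine ⟨a1, a2, ?_⟩
    refine hsucc (n + 2) _ _ a2 (hin 3 (by omega) (by omega)) (by omega) ?_
    intro x hx hlt
    omega
  have stepB : ∀ n p, posSeq G n = p → p + 1 ∈ G → p + 2 ∈ G → p + 3 ∈ G →
      posSeq G (n + 1) = p + 1 ∧ posSeq G (n + 2) = p + 2 ∧ posSeq G (n + 3) = p + 3 := by
    intro n p hn h1 h2 h3
    have a1 := hsucc n p (p + 1) hn h1 (by omega) (fun x _ h => h)
    have a2 := hsucc (n + 1) _ (p + 2) a1 h2 (by omega) (fun x _ h => h)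
    exact ⟨a1, a2, hsucc (n + 2) _ (p + 3) a2 h3 (by omega) (fun x _ h => h)⟩
  have h12 := stepA 0 1 (by omega) (by omega) h0
  have h1 : posSeq G 1 = 6 * k + 1 := by rw [h12.1]; omega
  have h2 : posSeq G 2 = 6 * k + 3 := by rw [h12.2.1]; omega
  refine ⟨?_, ?_, ?_⟩
  · apply (Set.finite_Iio ((2 * k + 1) * (3 * k + 2))).subset
    intro x hx
    by_contra hc
    exact hx (hlarge x (by simpa using hc))
  · have : posSeq G '' Set.Iio 3 = {3 * k + 2, 6 * k + 1, 6 * k + 3} := by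
      have : (Set.Iio 3 : Set ℕ) = {0, 1, 2} := by
        ext x; simp; omega
      rw [this, Set.image_insert_eq, Set.image_insert_eq, Set.image_singleton, h0, h1, h2, one_mul]
    rw [this]
  · -- residues of one block
    have hA : ∀ n w, 1 ≤ w → w ≤ 2 * k → posSeq G n = w * (3 * k + 2) →
        (posSeq G n % 3 ≠ posSeq G (n + 1) % 3 ∧ posSeq G n % 3 ≠ posSeq G (n + 2) % 3 ∧
        posSeq G (n + 1) % 3 ≠ posSeq G (n + 2) % 3) := by
      intro n w hw1 hw2 hn
      obtain ⟨a1, a2, -⟩ := stepA n w hw1 hw2 hn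
      have e : (w + 1) * (3 * k + 2) = w * (3 * k + 2) + (3 * k + 2) := by ring
      rw [hn, a1, a2]
      omega
    have key : ∀ j, (∃ w i, 1 ≤ w ∧ w ≤ 2 * k + 1 ∧ (i = 0 ∨ i < w / 2) ∧
          posSeq G (j * 3) + 3 * i = w * (3 * k + 2)) ∨
        (2 * k + 1) * (3 * k + 2) ≤ posSeq G (j * 3) := by
      intro j
      induction j with
      | zero => exact Or.inl ⟨1, 0, by omega, by omega, by omega, by simpa using h0⟩
      | succ j ih =>
        rw [show (j + 1) * 3 = j * 3 + 3 by ring]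
        by_cases hL : (2 * k + 1) * (3 * k + 2) ≤ posSeq G (j * 3)
        · right
          have := stepB (j * 3) _ rfl (hlarge _ (by omega)) (hlarge _ (by omega))
            (hlarge _ (by omega))
          omega
        · obtain ⟨w, i, hw1, hw2, hi, he⟩ := ih.resolve_right hL
          left
          rcases Nat.eq_zero_or_pos i with rfl | hi0
          · have hw : w ≤ 2 * k := by
              by_contra hc
              obtain rfl : w = 2 * k + 1 := by omega
              omega
            obtain ⟨-, -, a3⟩ := stepA (j * 3) w hw1 hw he
            have e : (w + 1) * (3 * k + 2) = w * (3 * k + 2) + (3 * k + 2) := by ring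
            exact ⟨w + 1, (w + 1) / 2 - 1, by omega, by omega, by omega, by omega⟩
          · obtain ⟨-, -, a3⟩ := stepB (j * 3) _ rfl
              ((hmem _).2 ⟨w, 3 * i - 1, by omega, by omega, by omega⟩)
              ((hmem _).2 ⟨w, 3 * i - 2, by omega, by omega, by omega⟩)
              ((hmem _).2 ⟨w, 3 * i - 3, by omega, by omega, by omega⟩)
            exact ⟨w, i - 1, by omega, by omega, by omega, by omega⟩
    have res : ∀ j, (posSeq G (j * 3) % 3 ≠ posSeq G (j * 3 + 1) % 3 ∧
        posSeq G (j * 3) % 3 ≠ posSeq G (j * 3 + 2) % 3 ∧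
        posSeq G (j * 3 + 1) % 3 ≠ posSeq G (j * 3 + 2) % 3) := by
      intro j
      by_cases hL : (2 * k + 1) * (3 * k + 2) ≤ posSeq G (j * 3)
      · have := stepB (j * 3) _ rfl (hlarge _ (by omega)) (hlarge _ (by omega))
          (hlarge _ (by omega))
        omega
      · obtain ⟨w, i, hw1, hw2, hi, he⟩ := (key j).resolve_right hL
        rcases Nat.eq_zero_or_pos i with rfl | hi0
        · have hw : w ≤ 2 * k := by
            by_contra hc
            obtain rfl : w = 2 * k + 1 := by omega
            omega
          exact hA _ w hw1 hw he
        · have := stepB (j * 3) _ rfl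
            ((hmem _).2 ⟨w, 3 * i - 1, by omega, by omega, by omega⟩)
            ((hmem _).2 ⟨w, 3 * i - 2, by omega, by omega, by omega⟩)
            ((hmem _).2 ⟨w, 3 * i - 3, by omega, by omega, by omega⟩)
          omega
    intro j
    rw [Fintype.bijective_iff_injective_and_card]
    refine ⟨?_, by simp⟩
    intro x y hxy
    have hxy' := (ZMod.natCast_eq_natCast_iff' _ _ 3).1 hxy
    obtain ⟨r1, r2, r3⟩ := res j
    fin_cases x <;> fin_cases y <;> simp at hxy' ⊢ <;> omega
end
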